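/- Let D be a face-convex good drawing of K_n in the sphere with outer face F. Then there exists a linear ordering of the vertices of K_n with the intermediate value property: for every 3-cycle T of K_n and every vertex x whose point lies in the interior of the closed disc bounded by D[T] not containing F, x is neither the minimum nor the maximum, in the ordering, of the set consisting of x and the three vertices of T. -/

import Mathlib

open Set Topology

noncomputable section

abbrev Plane : Type := EuclideanSpace ℝ (Fin 2)

abbrev SpherePt : Type := ↥(Metric.sphere (0 : EuclideanSpace ℝ (Fin 3)) 1)

/-- `γ` crosses the curve `σ` at `p`: `p` lies on both sets, and in every neighbourhood of `p`
there is a smaller neighbourhood `V` such that `V \ σ` splits into two connected "sides",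
both of which meet `γ`. -/
def CrossesAt {X : Type*} [TopologicalSpace X] (σ γ : Set X) (p : X) : Prop :=
  p ∈ σ ∧ p ∈ γ ∧ ∀ U ∈ nhds p, ∃ V ∈ nhds p, V ⊆ U ∧
    ∃ C₁ C₂ : Set X, V \ σ = C₁ ∪ C₂ ∧ Disjoint C₁ C₂ ∧
      IsPreconnected C₁ ∧ IsPreconnected C₂ ∧ (γ ∩ C₁).Nonempty ∧ (γ ∩ C₂).Nonempty

/-- `Δ` is one of the closed regions ("closed discs") bounded by the curve `C`:
it is the union of `C` with a connected component of the complement of `C`. -/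
def IsClosedSide {X : Type*} [TopologicalSpace X] (C Δ : Set X) : Prop :=
  ∃ q, q ∉ C ∧ Δ = connectedComponentIn Cᶜ q ∪ C

/-- `Δ` is one of the open regions ("open discs") bounded by the curve `C`. -/
def IsOpenSide {X : Type*} [TopologicalSpace X] (C Δ : Set X) : Prop :=
  ∃ q, q ∉ C ∧ Δ = connectedComponentIn Cᶜ q

/-- `G` is a face (a connected component of the complement) of the point set `A`. -/
def IsFaceOf {X : Type*} [TopologicalSpace X] (A G : Set X) : Prop :=
  ∃ q, q ∉ A ∧ G = connectedComponentIn Aᶜ q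

/-- A good drawing of the complete graph `K_n` in the space `X`. -/
structure GoodDrawing (n : ℕ) (X : Type*) [TopologicalSpace X] where
  vtx : Fin n → X
  arc : Fin n → Fin n → Set X
  vtx_inj : Function.Injective vtx
  arc_symm : ∀ u v, arc u v = arc v u
  isArc : ∀ u v, u ≠ v → ∃ f : ℝ → X, ContinuousOn f (Set.Icc 0 1) ∧
    Set.InjOn f (Set.Icc 0 1) ∧ f 0 = vtx u ∧ f 1 = vtx v ∧ arc u v = f '' Set.Icc 0 1
  vtx_not_mem : ∀ u v w, u ≠ v → w ≠ u → w ≠ v → vtx w ∉ arc u v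
  adj_arcs : ∀ u v w, u ≠ v → u ≠ w → v ≠ w → arc u v ∩ arc u w = {vtx u}
  indep_arcs : ∀ u v x y : Fin n, u ≠ v → x ≠ y → u ≠ x → u ≠ y → v ≠ x → v ≠ y →
    (arc u v ∩ arc x y).Subsingleton ∧
      ∀ p ∈ arc u v ∩ arc x y,
        CrossesAt (arc u v) (arc x y) p ∧ CrossesAt (arc x y) (arc u v) p
  no_triple_pt : ∀ p : X, p ∉ Set.range vtx → ∀ u v x y s t : Fin n,
    u ≠ v → x ≠ y → s ≠ t →
    ({u, v} : Finset (Fin n)) ≠ {x, y} → ({u, v} : Finset (Fin n)) ≠ {s, t} →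
    ({x, y} : Finset (Fin n)) ≠ {s, t} →
    ¬(p ∈ arc u v ∧ p ∈ arc x y ∧ p ∈ arc s t)

namespace GoodDrawing

variable {n : ℕ} {X : Type*} [TopologicalSpace X]

/-- The point set of the subdrawing induced by the set `W` of vertices. -/
def image (D : GoodDrawing n X) (W : Set (Fin n)) : Set X :=
  (D.vtx '' W) ∪ ⋃ u ∈ W, ⋃ v ∈ W, ⋃ (_ : u ≠ v), D.arc u v

/-- The simple closed curve that is the drawing of the 3-cycle on `a`, `b`, `c`. -/
def tri (D : GoodDrawing n X) (a b c : Fin n) : Set X :=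
  D.arc a b ∪ D.arc b c ∪ D.arc a c

/-- `Δ` is convex: it contains the arc between any two vertex points it contains. -/
def ConvexDisc (D : GoodDrawing n X) (Δ : Set X) : Prop :=
  ∀ x y : Fin n, x ≠ y → D.vtx x ∈ Δ → D.vtx y ∈ Δ → D.arc x y ⊆ Δ

/-- `F` is a face of the drawing `D`. -/
def IsFace (D : GoodDrawing n X) (F : Set X) : Prop :=
  IsFaceOf (D.image Set.univ) F

/-- `D` is face-convex with outer face `F`. -/
def FaceConvex (D : GoodDrawing n X) (F : Set X) : Prop :=
  D.IsFace F ∧ ∀ a b c : Fin n, a ≠ b → a ≠ c → b ≠ c →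
    ∀ Δ : Set X, IsClosedSide (D.tri a b c) Δ → ¬F ⊆ Δ → D.ConvexDisc Δ

/-- `D` is a convex drawing: every 3-cycle has at least one convex closed side. -/
def IsConvex (D : GoodDrawing n X) : Prop :=
  ∀ a b c : Fin n, a ≠ b → a ≠ c → b ≠ c →
    ∃ Δ : Set X, IsClosedSide (D.tri a b c) Δ ∧ D.ConvexDisc Δ

/-- The closed curve drawn by the cycle `c 0, c 1, …, c (m-1), c 0` of `K_n`. -/
def cycCurve (D : GoodDrawing n X) {m : ℕ} [NeZero m] (c : Fin m → Fin n) : Set X :=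
  ⋃ i : Fin m, D.arc (c i) (c (i + 1))

/-- `Δ` is the convex hull `Δ_W` of the vertex set `W` (relative to the outer face `F`):
the face of the subdrawing `D[W]` containing `F` is bounded by a cycle `C_W` on vertices
of `W`, and `Δ` is the closed disc bounded by `D[C_W]` disjoint from `F`. -/
def IsHull (D : GoodDrawing n X) (F : Set X) (W : Set (Fin n)) (Δ : Set X) : Prop :=
  ∃ (m : ℕ) (c : Fin (m + 3) → Fin n), Function.Injective c ∧ (∀ i, c i ∈ W) ∧
    (∃ G : Set X, IsFaceOf (D.image W) G ∧ F ⊆ G ∧ frontier G = D.cycCurve c) ∧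
    IsClosedSide (D.cycCurve c) Δ ∧ Disjoint F Δ

/-- The data of the two local sides `C 0`, `C 1` of the arc `D[uv]` at an interior
point `p` of the arc. -/
def LocalSides (D : GoodDrawing n X) (u v : Fin n) (p : X) (C : Fin 2 → Set X) : Prop :=
  p ∈ D.arc u v ∧ p ≠ D.vtx u ∧ p ≠ D.vtx v ∧
    ∃ V ∈ nhds p, C 0 ∪ C 1 = V \ D.arc u v ∧ Disjoint (C 0) (C 1) ∧
      IsPreconnected (C 0) ∧ IsPreconnected (C 1) ∧ (C 0).Nonempty ∧ (C 1).Nonempty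

/-- Relative to the outer face `F` and the local sides `C` of `D[uv]` at `p`, the
vertex `w` is on side `i` of `uv`: the closed disc bounded by `D[{u,v,w}]` not
containing `F` lies locally on side `i` of `D[uv]`. -/
def OnSide (D : GoodDrawing n X) (F : Set X) (u v : Fin n) (p : X) (C : Fin 2 → Set X)
    (i : Fin 2) (w : Fin n) : Prop :=
  w ≠ u ∧ w ≠ v ∧ ∃ Δ : Set X, IsClosedSide (D.tri u v w) Δ ∧ ¬F ⊆ Δ ∧
    ∃ V ∈ nhds p, C i ∩ V ⊆ Δ

/-- `Side(uv, i)`: the set consisting of `u`, `v` and all vertices on side `i` of `uv`. -/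
def SideSet (D : GoodDrawing n X) (F : Set X) (u v : Fin n) (p : X) (C : Fin 2 → Set X)
    (i : Fin 2) : Set (Fin n) :=
  {u, v} ∪ {w : Fin n | D.OnSide F u v p C i w}

/-- The edge-arcs `D[uv]` and `D[xy]` cross: they share a non-vertex point. -/
def Crosses (D : GoodDrawing n X) (u v x y : Fin n) : Prop :=
  ∃ p : X, p ∈ D.arc u v ∩ D.arc x y ∧ p ∉ Set.range D.vtx

/-- The set of empty triangles of `D`: pairs of a 3-set of vertices together with an
open disc bounded by the corresponding triangle containing no vertex point. -/
def emptyTriangles (D : GoodDrawing n X) : Set (Finset (Fin n) × Set X) :=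
  {T | ∃ a b c : Fin n, a ≠ b ∧ a ≠ c ∧ b ≠ c ∧ T.1 = {a, b, c} ∧
    IsOpenSide (D.tri a b c) T.2 ∧ ∀ i, D.vtx i ∉ T.2}

end GoodDrawing

/-- A pseudoline in the plane. -/
def IsPseudoline (σ : Set Plane) : Prop :=
  IsClosed σ ∧ Nonempty (↥σ ≃ₜ ℝ) ∧ ¬IsPreconnected σᶜ

/-- An arrangement of pseudolines: any two distinct members meet in exactly one
point, at which they cross. -/
def IsArrangement (A : Finset (Set Plane)) : Prop :=
  (∀ σ ∈ A, IsPseudoline σ) ∧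
    ∀ σ ∈ A, ∀ τ ∈ A, σ ≠ τ →
      ∃ p : Plane, σ ∩ τ = {p} ∧ CrossesAt σ τ p ∧ CrossesAt τ σ p

/-- A planar good drawing of `K_n` is pseudolinear if some arrangement of pseudolines
contains, for each edge, a distinct pseudoline containing that edge-arc. -/
def GoodDrawing.Pseudolinear {n : ℕ} (D : GoodDrawing n Plane) : Prop :=
  ∃ (A : Finset (Set Plane)) (L : Fin n → Fin n → Set Plane), IsArrangement A ∧
    (∀ u v, u ≠ v → L u v ∈ A ∧ D.arc u v ⊆ L u v) ∧
    (∀ u v, L u v = L v u) ∧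
    ∀ u v x y : Fin n, u ≠ v → x ≠ y →
      ({u, v} : Finset (Fin n)) ≠ {x, y} → L u v ≠ L x y

namespace IVO

lemma const_of_int {X : Type*} [TopologicalSpace X] {S : Set X} (hS : IsPreconnected S)
    {f : X → ℝ} (hf : ContinuousOn f S) (hi : ∀ x ∈ S, ∃ m : ℤ, f x = m)
    {x y : X} (hx : x ∈ S) (hy : y ∈ S) : f x = f y := by
  have hd : DiscreteTopology (Set.range ((↑) : ℤ → ℝ)) :=
    Int.isClosedEmbedding_coe_real.isEmbedding.toHomeomorph.symm.isEmbedding.discreteTopology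
  refine hS.constant_of_mapsTo (T := Set.range ((↑) : ℤ → ℝ)) ⟨hd⟩ hf ?_ hx hy
  intro z hz
  obtain ⟨m, hm⟩ := hi z hz
  exact ⟨m, hm.symm⟩

lemma lift_unique {X : Type*} [TopologicalSpace X] {S : Set X} (hS : IsPreconnected S)
    {f g : X → ℂ} (hf : ContinuousOn f S) (hg : ContinuousOn g S)
    (h : ∀ x ∈ S, Complex.exp (f x) = Complex.exp (g x))
    {x y : X} (hx : x ∈ S) (hy : y ∈ S) : f x - g x = f y - g y := by
  have key : ∀ z ∈ S, ∃ m : ℤ, f z - g z = m * (2 * Real.pi * Complex.I) := by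
    intro z hz
    obtain ⟨m, hm⟩ := Complex.exp_eq_exp_iff_exists_int.1 (h z hz)
    exact ⟨m, by rw [hm]; ring⟩
  have hpi : (2 * Real.pi : ℝ) ≠ 0 := by positivity
  have him : ∀ z ∈ S, ∃ m : ℤ, (f z - g z).im / (2 * Real.pi) = m := by
    intro z hz
    obtain ⟨m, hm⟩ := key z hz
    refine ⟨m, ?_⟩
    rw [hm]
    simp
  have hc : ContinuousOn (fun z => (f z - g z).im / (2 * Real.pi)) S := by
    have := (Complex.continuous_im.comp_continuousOn (hf.sub hg))
    exact this.div_const _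
  have e := const_of_int hS hc him hx hy
  have e' : (f x - g x).im = (f y - g y).im := by
    field_simp at e; exact e
  obtain ⟨m, hm⟩ := key x hx
  obtain ⟨k, hk⟩ := key y hy
  apply Complex.ext _ e'
  rw [hm, hk]; simp

lemma lift_Icc {a b : ℝ} (hab : a ≤ b) {γ : ℝ → ℂ} (hc : ContinuousOn γ (Icc a b))
    (h0 : ∀ t ∈ Icc a b, γ t ≠ 0) :
    ∃ Γ : ℝ → ℂ, ContinuousOn Γ (Icc a b) ∧ ∀ t ∈ Icc a b, Complex.exp (Γ t) = γ t := by
  have hc' : Continuous (Set.IccExtend hab ((Icc a b).domRestrict γ)) :=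
    (continuousOn_iff_continuous_domRestrict.1 hc).Icc_extend'
  have hsc : IsSimplyConnected (univ : Set ℝ) := by
    have := (convex_univ (𝕜 := ℝ) (E := ℝ)).contractibleSpace univ_nonempty
    exact SimplyConnectedSpace.ofContractible _
  obtain ⟨f, hf, hfe⟩ := Complex.exists_continuousOn_eqOn_exp_comp
    (U := (univ : Set ℝ)) hsc isOpen_univ
    (g := Set.IccExtend hab ((Icc a b).domRestrict γ)) hc'.continuousOn (by
      rintro ⟨t, -, ht⟩
      rw [Set.IccExtend] at ht
      exact h0 _ (projIcc a b hab t).2 ht)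
  refine ⟨f, hf.mono (subset_univ _), fun t ht => ?_⟩
  have := hfe (mem_univ t)
  rw [Function.comp] at this
  rw [this, Set.IccExtend_of_mem _ _ ht]
  rfl

lemma lift_plane {h : ℂ → ℂ} (hc : Continuous h) (h0 : ∀ z, h z ≠ 0) :
    ∃ g : ℂ → ℂ, Continuous g ∧ ∀ z, Complex.exp (g z) = h z := by
  have hsc : IsSimplyConnected (univ : Set ℂ) := by
    have := (convex_univ (𝕜 := ℝ) (E := ℂ)).contractibleSpace univ_nonempty
    exact SimplyConnectedSpace.ofContractible _
  obtain ⟨f, hf, hfe⟩ := Complex.exists_continuousOn_eqOn_exp_comp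
    (U := (univ : Set ℂ)) hsc isOpen_univ (g := h) hc.continuousOn (by
      rintro ⟨t, -, ht⟩; exact h0 t ht)
  exact ⟨f, continuousOn_univ.1 hf, fun z => hfe (mem_univ z)⟩

/-- No continuous logarithm of `(z-p)^k` on a circle around `p` unless `k = 0`. -/
lemma circle_log {p : ℂ} {R : ℝ} (hR : 0 < R) {k : ℤ} {g : ℂ → ℂ}
    (hg : ContinuousOn g (Metric.sphere p R))
    (he : ∀ z ∈ Metric.sphere p R, Complex.exp (g z) = (z - p) ^ k) : k = 0 := by
  have hm : ∀ t : ℝ, circleMap p R t ∈ Metric.sphere p R := circleMap_mem_sphere p hR.le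
  have h1 : ContinuousOn (fun t : ℝ => g (circleMap p R t)) univ :=
    hg.comp (continuous_circleMap p R).continuousOn (fun t _ => hm t)
  have h2 : ContinuousOn (fun t : ℝ => (k : ℂ) * (Real.log R + t * Complex.I)) univ := by
    fun_prop
  have h3 := lift_unique isPreconnected_univ h1 h2 (fun t _ => by
    rw [he _ (hm t), circleMap, add_sub_cancel_left, Complex.exp_int_mul, Complex.exp_add,
      ← Complex.ofReal_exp, Real.exp_log hR]) (mem_univ 0) (mem_univ (2 * Real.pi))
  have h4 : circleMap p R (2 * Real.pi) = circleMap p R 0 := by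
    simpa using periodic_circleMap p R 0
  simp only [h4] at h3
  have h5 : (k : ℂ) * (2 * Real.pi * Complex.I) = 0 := by
    have := h3
    push_cast at this
    linear_combination this
  rcases mul_eq_zero.1 h5 with h | h
  · exact_mod_cast h
  · exact absurd h Complex.two_pi_I_ne_zero

/-- Continuous logarithms of `h` on `K`. -/
def HasLog (h : ℂ → ℂ) (K : Set ℂ) : Prop :=
  ∃ g : ℂ → ℂ, ContinuousOn g K ∧ ∀ z ∈ K, Complex.exp (g z) = h z

lemma HasLog.mono {h : ℂ → ℂ} {K L : Set ℂ} (hK : HasLog h K) (hL : L ⊆ K) : HasLog h L := by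
  obtain ⟨g, hg, he⟩ := hK
  exact ⟨g, hg.mono hL, fun z hz => he z (hL hz)⟩

lemma eilenberg {U : Set ℂ} (hU : IsOpen U) (hb : Bornology.IsBounded U) {p : ℂ} (hp : p ∈ U)
    {k : ℤ} {φ g : ℂ → ℂ} (hφ : ContinuousOn φ (closure U)) (hφ0 : ∀ z ∈ closure U, φ z ≠ 0)
    (hg : ContinuousOn g (frontier U))
    (he : ∀ z ∈ frontier U, Complex.exp (g z) * φ z = (z - p) ^ k) : k = 0 := by
  classical
  obtain ⟨G, hG⟩ := ContinuousMap.exists_restrict_eq (isClosed_frontier (s := U))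
    ⟨(frontier U).domRestrict g, continuousOn_iff_continuous_domRestrict.1 hg⟩
  have hGe : ∀ z ∈ frontier U, G z = g z := by
    intro z hz
    have := congrArg (fun f => f ⟨z, hz⟩) hG
    simpa using this
  let H : ℂ → ℂ := fun z => if z ∈ closure U then Complex.exp (G z) * φ z else (z - p) ^ k
  have hne : ∀ z, z ∉ U → z - p ≠ 0 := fun z hz h => hz (by rwa [sub_eq_zero.1 h])
  have hH0 : ∀ z, H z ≠ 0 := by
    intro z
    by_cases hz : z ∈ closure U
    · simp only [H, hz, if_true]; exact mul_ne_zero (Complex.exp_ne_zero _) (hφ0 z hz)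
    · simp only [H, hz, if_false]
      exact zpow_ne_zero _ (hne z fun h => hz (subset_closure h))
  have hHc : Continuous H := by
    have hcov : closure U ∪ Uᶜ = univ := by
      ext z; by_cases hz : z ∈ U
      · simp [subset_closure hz]
      · simp [hz]
    rw [← continuousOn_univ, ← hcov]
    refine ContinuousOn.union_of_isClosed ?_ ?_ isClosed_closure hU.isClosed_compl
    · refine ContinuousOn.congr (f := fun z => Complex.exp (G z) * φ z) ?_ ?_
      · exact (Complex.continuous_exp.comp G.continuous).continuousOn.mul hφ
      · intro z hz; simp only [H, hz, if_true]
    · refine ContinuousOn.congr (f := fun z => (z - p) ^ k) ?_ ?_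
      · intro z hz
        exact ((continuousAt_id.sub continuousAt_const).zpow₀ k
          (Or.inl (hne z hz))).continuousWithinAt
      · intro z hz
        by_cases h : z ∈ closure U
        · have hf : z ∈ frontier U := by rw [hU.frontier_eq]; exact ⟨h, hz⟩
          simp only [H, h, if_true]
          rw [hGe z hf, he z hf]
        · simp only [H, h, if_false]
  obtain ⟨l, hl, hle⟩ := lift_plane hHc hH0
  obtain ⟨R, hR0, hR⟩ := hb.closure.subset_ball_lt 0 p
  refine circle_log hR0 (p := p) (g := l) hl.continuousOn fun z hz => ?_
  have : z ∉ closure U := fun h => by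
    have h1 := hR h
    simp only [Metric.mem_ball, Metric.mem_sphere] at h1 hz
    linarith
  rw [hle]; simp only [H, this, if_false]

end IVO

namespace IVO

open Classical in
/-- Increment of a continuous logarithm along a path in `ℂ \ {0}`. -/
def inc (γ : ℝ → ℂ) : ℂ :=
  if h : ∃ Γ : ℝ → ℂ, ContinuousOn Γ (Icc 0 1) ∧ ∀ t ∈ Icc (0 : ℝ) 1, Complex.exp (Γ t) = γ t
  then h.choose 1 - h.choose 0 else 0

lemma z01 : (0 : ℝ) ∈ Icc (0 : ℝ) 1 := by simp
lemma o01 : (1 : ℝ) ∈ Icc (0 : ℝ) 1 := by simp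

lemma inc_eq {γ Γ : ℝ → ℂ} (hc : ContinuousOn Γ (Icc 0 1))
    (he : ∀ t ∈ Icc (0 : ℝ) 1, Complex.exp (Γ t) = γ t) : inc γ = Γ 1 - Γ 0 := by
  have h : ∃ Γ : ℝ → ℂ, ContinuousOn Γ (Icc 0 1) ∧ ∀ t ∈ Icc (0 : ℝ) 1,
    Complex.exp (Γ t) = γ t := ⟨Γ, hc, he⟩
  rw [inc, dif_pos h]
  have := lift_unique isPreconnected_Icc h.choose_spec.1 hc
    (fun t ht => (h.choose_spec.2 t ht).trans (he t ht).symm) z01 o01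
  linear_combination -this

/-- Log increment of `f - p` along `f`. -/
def ell (f : ℝ → ℂ) (p : ℂ) : ℂ := inc (fun t => f t - p)

/-- image of the unit interval -/
def im (f : ℝ → ℂ) : Set ℂ := f '' Icc (0 : ℝ) 1

lemma im_compact {f : ℝ → ℂ} (hf : ContinuousOn f (Icc 0 1)) : IsCompact (im f) :=
  isCompact_Icc.image_of_continuousOn hf

lemma im_closed {f : ℝ → ℂ} (hf : ContinuousOn f (Icc 0 1)) : IsClosed (im f) :=
  (im_compact hf).isClosed

lemma mem_im {f : ℝ → ℂ} {t : ℝ} (ht : t ∈ Icc (0 : ℝ) 1) : f t ∈ im f := ⟨t, ht, rfl⟩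

lemma sub_ne {f : ℝ → ℂ} {p : ℂ} (hp : p ∉ im f) : ∀ t ∈ Icc (0 : ℝ) 1, f t - p ≠ 0 :=
  fun t ht h => hp ⟨t, ht, sub_eq_zero.1 h⟩

lemma exists_lift {f : ℝ → ℂ} (hf : ContinuousOn f (Icc 0 1)) {p : ℂ} (hp : p ∉ im f) :
    ∃ Γ : ℝ → ℂ, ContinuousOn Γ (Icc 0 1) ∧
      (∀ t ∈ Icc (0 : ℝ) 1, Complex.exp (Γ t) = f t - p) ∧ ell f p = Γ 1 - Γ 0 := by
  obtain ⟨Γ, h1, h2⟩ := lift_Icc zero_le_one (hf.sub continuousOn_const) (sub_ne hp)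
  exact ⟨Γ, h1, h2, inc_eq h1 h2⟩

lemma exp_ell {f : ℝ → ℂ} (hf : ContinuousOn f (Icc 0 1)) {p : ℂ} (hp : p ∉ im f) :
    Complex.exp (ell f p) = (f 1 - p) / (f 0 - p) := by
  obtain ⟨Γ, h1, h2, h3⟩ := exists_lift hf hp
  rw [h3, Complex.exp_sub, h2 _ z01, h2 _ o01]

lemma ell_rev {f : ℝ → ℂ} (hf : ContinuousOn f (Icc 0 1)) {p : ℂ} (hp : p ∉ im f) :
    ell (fun t => f (1 - t)) p = - ell f p := by
  obtain ⟨Γ, h1, h2, h3⟩ := exists_lift hf hp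
  have hm : ∀ t ∈ Icc (0 : ℝ) 1, 1 - t ∈ Icc (0 : ℝ) 1 := fun t ht =>
    ⟨by linarith [ht.2], by linarith [ht.1]⟩
  have : ell (fun t => f (1 - t)) p = Γ (1 - 1) - Γ (1 - 0) :=
    inc_eq (Γ := fun t => Γ (1 - t))
      (h1.comp (by fun_prop) hm) (fun t ht => h2 _ (hm t ht))
  rw [this, h3]; simp

lemma slit_of {u : ℂ} (hu : ‖u‖ < 1) : 1 - u ∈ Complex.slitPlane := by
  left
  have := Complex.re_le_norm u
  simp only [Complex.sub_re, Complex.one_re]; linarith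

lemma ell_near {f : ℝ → ℂ} (hf : ContinuousOn f (Icc 0 1)) {p q : ℂ}
    (h : ∀ t ∈ Icc (0 : ℝ) 1, ‖p - q‖ < ‖f t - q‖) :
    ell f p = ell f q + (Complex.log (1 - (p - q) / (f 1 - q)) -
      Complex.log (1 - (p - q) / (f 0 - q))) := by
  have hne : ∀ t ∈ Icc (0 : ℝ) 1, f t - q ≠ 0 := fun t ht h0 => by
    have := h t ht; rw [h0, norm_zero] at this; exact absurd this (norm_nonneg _).not_gt
  have hq : q ∉ im f := by
    rintro ⟨t, ht, rfl⟩; exact hne t ht (sub_self _)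
  obtain ⟨Γ, h1, h2, h3⟩ := exists_lift hf hq
  have hs : ∀ t ∈ Icc (0 : ℝ) 1, 1 - (p - q) / (f t - q) ∈ Complex.slitPlane := fun t ht => by
    apply slit_of
    rw [norm_div, div_lt_one (norm_pos_iff.2 (hne t ht))]
    exact h t ht
  have : ell f p = (Γ 1 + Complex.log (1 - (p - q) / (f 1 - q))) -
      (Γ 0 + Complex.log (1 - (p - q) / (f 0 - q))) := by
    refine inc_eq (Γ := fun t => Γ t + Complex.log (1 - (p - q) / (f t - q))) ?_ ?_
    · refine h1.add (ContinuousOn.clog ?_ hs)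
      exact continuousOn_const.sub (continuousOn_const.div (hf.sub continuousOn_const) hne)
    · intro t ht
      rw [Complex.exp_add, h2 t ht, Complex.exp_log (Complex.slitPlane_ne_zero (hs t ht))]
      have := hne t ht
      field_simp
      ring
  rw [this, h3]; ring

lemma ell_far {f : ℝ → ℂ} (hf : ContinuousOn f (Icc 0 1)) {p : ℂ}
    (h : ∀ t ∈ Icc (0 : ℝ) 1, ‖f t‖ < ‖p‖) :
    ell f p = Complex.log (1 - f 1 / p) - Complex.log (1 - f 0 / p) := by
  have hp : p ≠ 0 := fun h0 => by
    have := h 0 z01; rw [h0, norm_zero] at this; exact absurd this (norm_nonneg _).not_gt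
  have hs : ∀ t ∈ Icc (0 : ℝ) 1, 1 - f t / p ∈ Complex.slitPlane := fun t ht => by
    apply slit_of
    rw [norm_div, div_lt_one (norm_pos_iff.2 hp)]
    exact h t ht
  have : ell f p = (Complex.log (-p) + Complex.log (1 - f 1 / p)) -
      (Complex.log (-p) + Complex.log (1 - f 0 / p)) := by
    refine inc_eq (Γ := fun t => Complex.log (-p) + Complex.log (1 - f t / p)) ?_ ?_
    · exact continuousOn_const.add (ContinuousOn.clog
        (continuousOn_const.sub (hf.div_const _)) hs)
    · intro t ht
      rw [Complex.exp_add, Complex.exp_log (neg_ne_zero.2 hp),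
        Complex.exp_log (Complex.slitPlane_ne_zero (hs t ht))]
      field_simp
      ring
  rw [this]; ring

lemma near_cond {f : ℝ → ℂ} (hf : ContinuousOn f (Icc 0 1)) {q : ℂ} (hq : q ∉ im f) :
    ∀ᶠ p in 𝓝 q, ∀ t ∈ Icc (0 : ℝ) 1, ‖p - q‖ < ‖f t - q‖ := by
  obtain ⟨ε, hε, hb⟩ := Metric.isOpen_iff.1 (im_closed hf).isOpen_compl q hq
  filter_upwards [Metric.ball_mem_nhds q hε] with p hp t ht
  rw [Metric.mem_ball, dist_eq_norm] at hp
  refine hp.trans_le ?_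
  by_contra hlt
  exact hb (by rw [Metric.mem_ball, dist_eq_norm]; exact not_le.1 hlt) (mem_im ht)

lemma ell_continuousAt {f : ℝ → ℂ} (hf : ContinuousOn f (Icc 0 1)) {q : ℂ} (hq : q ∉ im f) :
    ContinuousAt (ell f) q := by
  have hne := sub_ne hq
  have hc : ∀ t ∈ Icc (0 : ℝ) 1,
      ContinuousAt (fun p => Complex.log (1 - (p - q) / (f t - q))) q := fun t ht => by
    refine ContinuousAt.clog ?_ ?_
    · fun_prop
    · simp
  refine ContinuousAt.congr (f := fun p => ell f q + (Complex.log (1 - (p - q) / (f 1 - q)) -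
      Complex.log (1 - (p - q) / (f 0 - q)))) ?_ ?_
  · exact continuousAt_const.add ((hc 1 o01).sub (hc 0 z01))
  · filter_upwards [near_cond hf hq] with p hp
    exact (ell_near hf hp).symm

lemma arc_transfer {a b : ℝ} {f F : ℝ → ℂ} (hf : ContinuousOn f (Icc a b))
    (hi : InjOn f (Icc a b)) (hF : ContinuousOn F (Icc a b)) :
    ∃ G : ℂ → ℂ, ContinuousOn G (f '' Icc a b) ∧ ∀ t ∈ Icc a b, G (f t) = F t := by
  have hinv : ∀ t ∈ Icc a b, Function.invFunOn f (Icc a b) (f t) = t := fun t ht =>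
    hi.leftInvOn_invFunOn ht
  refine ⟨fun z => F (Function.invFunOn f (Icc a b) z), ?_, fun t ht => by simp only [hinv t ht]⟩
  rw [continuousOn_iff_isClosed]
  intro T hT
  obtain ⟨u, hu, hu'⟩ := (continuousOn_iff_isClosed.1 hF) T hT
  refine ⟨f '' (u ∩ Icc a b), ?_, ?_⟩
  · exact ((isCompact_Icc.inter_left hu).image_of_continuousOn
      (hf.mono inter_subset_right)).isClosed
  · ext z
    constructor
    · rintro ⟨h1, t, ht, rfl⟩
      simp only [mem_preimage, hinv t ht] at h1
      exact ⟨⟨t, by rw [← hu']; exact ⟨h1, ht⟩, rfl⟩, ⟨t, ht, rfl⟩⟩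
    · rintro ⟨⟨t, ht, rfl⟩, -⟩
      rw [← hu'] at ht
      exact ⟨by simpa only [mem_preimage, hinv t ht.2] using ht.1, t, ht.2, rfl⟩

lemma hasLog_arc {a b : ℝ} (hab : a ≤ b) {f : ℝ → ℂ} (hf : ContinuousOn f (Icc a b))
    (hi : InjOn f (Icc a b)) {p : ℂ} (hp : p ∉ f '' Icc a b) :
    HasLog (fun z => z - p) (f '' Icc a b) := by
  obtain ⟨Γ, h1, h2⟩ := lift_Icc hab (hf.sub continuousOn_const)
    (fun t ht h => hp ⟨t, ht, sub_eq_zero.1 h⟩)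
  obtain ⟨G, hG, hGe⟩ := arc_transfer hf hi h1
  refine ⟨G, hG, ?_⟩
  rintro _ ⟨t, ht, rfl⟩
  rw [hGe t ht, h2 t ht]; rfl

lemma glue {K L : Set ℂ} (hK : IsClosed K) (hL : IsClosed L) {g h : ℂ → ℂ}
    (hg : ContinuousOn g K) (hh : ContinuousOn h L) (he : ∀ z ∈ K, z ∈ L → g z = h z) :
    ∃ G : ℂ → ℂ, ContinuousOn G (K ∪ L) ∧ (∀ z ∈ K, G z = g z) ∧ ∀ z ∈ L, G z = h z := by
  classical
  have h1 : ∀ z ∈ K, (if z ∈ K then g z else h z) = g z := fun z hz => if_pos hz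
  have h2 : ∀ z ∈ L, (if z ∈ K then g z else h z) = h z := fun z hz => by
    by_cases h : z ∈ K
    · rw [if_pos h]; exact he z h hz
    · rw [if_neg h]
  refine ⟨fun z => if z ∈ K then g z else h z, ?_, h1, h2⟩
  exact ContinuousOn.union_of_isClosed (hg.congr h1) (hh.congr h2) hK hL

lemma HasLog.union {φ : ℂ → ℂ} {K L : Set ℂ} (hK : IsClosed K) (hL : IsClosed L)
    (h1 : HasLog φ K) (h2 : HasLog φ L) {z₀ : ℂ} (hz : K ∩ L ⊆ {z₀}) : HasLog φ (K ∪ L) := by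
  obtain ⟨g, hg, hge⟩ := h1
  obtain ⟨h, hh, hhe⟩ := h2
  by_cases h0 : z₀ ∈ K ∩ L
  · obtain ⟨G, hG, hG1, hG2⟩ := glue hK hL hg (h := fun z => h z + (g z₀ - h z₀))
      (hh.add continuousOn_const) (fun z a b => by
        have : z = z₀ := hz ⟨a, b⟩
        rw [this]; ring)
    refine ⟨G, hG, ?_⟩
    rintro z (hz | hz)
    · rw [hG1 z hz, hge z hz]
    · rw [hG2 z hz, Complex.exp_add, Complex.exp_sub, hge _ h0.1, ← hhe _ h0.2, hhe z hz,
        div_self (Complex.exp_ne_zero _), mul_one]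
  · obtain ⟨G, hG, hG1, hG2⟩ := glue hK hL hg hh (fun z a b => by
      have : z = z₀ := hz ⟨a, b⟩
      subst this; exact absurd ⟨a, b⟩ h0)
    refine ⟨G, hG, ?_⟩
    rintro z (hz | hz)
    · rw [hG1 z hz, hge z hz]
    · rw [hG2 z hz, hhe z hz]

end IVO

namespace IVO

structure IsTri (f g h : ℝ → ℂ) : Prop where
  cf : ContinuousOn f (Icc 0 1)
  cg : ContinuousOn g (Icc 0 1)
  ch : ContinuousOn h (Icc 0 1)
  jf : InjOn f (Icc 0 1)
  jg : InjOn g (Icc 0 1)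
  jh : InjOn h (Icc 0 1)
  efg : f 1 = g 0
  egh : g 1 = h 0
  ehf : h 1 = f 0
  ifg : im f ∩ im g ⊆ {f 1}
  igh : im g ∩ im h ⊆ {g 1}
  ihf : im h ∩ im f ⊆ {h 1}

def θ (f : ℝ → ℂ) (p : ℂ) : ℝ := (ell f p).im / (2 * Real.pi)

def wt (f g h : ℝ → ℂ) (p : ℂ) : ℝ := θ f p + θ g p + θ h p

def tri (f g h : ℝ → ℂ) : Set ℂ := im f ∪ im g ∪ im h

lemma tri_rot (f g h : ℝ → ℂ) : tri g h f = tri f g h := by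
  unfold tri; ext z; simp only [mem_union]; tauto

lemma wt_rot (f g h : ℝ → ℂ) (p : ℂ) : wt g h f p = wt f g h p := by
  unfold wt; ring

lemma θ_continuousAt {f : ℝ → ℂ} (hf : ContinuousOn f (Icc 0 1)) {q : ℂ} (hq : q ∉ im f) :
    ContinuousAt (θ f) q :=
  (Complex.continuous_im.continuousAt.comp (ell_continuousAt hf hq)).div_const _

lemma θ_rev {f : ℝ → ℂ} (hf : ContinuousOn f (Icc 0 1)) {q : ℂ} (hq : q ∉ im f) :
    θ (fun t => f (1 - t)) q = - θ f q := by
  unfold θ; rw [ell_rev hf hq]; simp [neg_div]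

namespace IsTri

variable {f g h : ℝ → ℂ}

lemma rot (T : IsTri f g h) : IsTri g h f :=
  ⟨T.cg, T.ch, T.cf, T.jg, T.jh, T.jf, T.egh, T.ehf, T.efg, T.igh, T.ihf, T.ifg⟩

lemma compact (T : IsTri f g h) : IsCompact (tri f g h) :=
  ((im_compact T.cf).union (im_compact T.cg)).union (im_compact T.ch)

lemma isClosed (T : IsTri f g h) : IsClosed (tri f g h) := T.compact.isClosed

lemma nf {p : ℂ} (hp : p ∉ tri f g h) : p ∉ im f ∧ p ∉ im g ∧ p ∉ im h :=
  ⟨fun a => hp (Or.inl (Or.inl a)), fun a => hp (Or.inl (Or.inr a)), fun a => hp (Or.inr a)⟩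

lemma ell_int (T : IsTri f g h) {p : ℂ} (hp : p ∉ tri f g h) :
    ∃ m : ℤ, ell f p + ell g p + ell h p = m * (2 * Real.pi * Complex.I) ∧ wt f g h p = m := by
  obtain ⟨hf, hg, hh⟩ := nf hp
  have h1 : Complex.exp (ell f p + ell g p + ell h p) = 1 := by
    rw [Complex.exp_add, Complex.exp_add, exp_ell T.cf hf, exp_ell T.cg hg, exp_ell T.ch hh,
      T.efg, T.egh, T.ehf]
    have a := sub_ne hf 0 z01
    have b := sub_ne hg 0 z01
    have c := sub_ne hh 0 z01
    field_simp
  obtain ⟨m, hm⟩ := Complex.exp_eq_one_iff.1 h1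
  refine ⟨m, hm, ?_⟩
  have := congrArg Complex.im hm
  have hpi : (Real.pi : ℝ) ≠ 0 := Real.pi_ne_zero
  simp at this
  unfold wt θ
  field_simp
  linarith

lemma wt_continuousOn (T : IsTri f g h) : ContinuousOn (wt f g h) (tri f g h)ᶜ := by
  intro p hp
  obtain ⟨hf, hg, hh⟩ := nf hp
  exact (((θ_continuousAt T.cf hf).add (θ_continuousAt T.cg hg)).add
    (θ_continuousAt T.ch hh)).continuousWithinAt

lemma wt_const (T : IsTri f g h) {S : Set ℂ} (hS : IsPreconnected S)
    (hd : S ⊆ (tri f g h)ᶜ) {p q : ℂ} (hp : p ∈ S) (hq : q ∈ S) :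
    wt f g h p = wt f g h q :=
  const_of_int hS (T.wt_continuousOn.mono hd) (fun x hx =>
    let ⟨m, _, hm⟩ := T.ell_int (hd hx); ⟨m, hm⟩) hp hq

lemma wt_near (T : IsTri f g h) {q : ℂ} (hq : q ∉ tri f g h) :
    ∀ᶠ p in 𝓝 q, p ∉ tri f g h ∧ wt f g h p = wt f g h q := by
  obtain ⟨ε, hε, hb⟩ := Metric.isOpen_iff.1 T.isClosed.isOpen_compl q hq
  filter_upwards [Metric.ball_mem_nhds q hε] with p hp
  exact ⟨hb hp, T.wt_const (convex_ball q ε).isPreconnected hb hp (Metric.mem_ball_self hε)⟩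

lemma wt_far (T : IsTri f g h) : ∃ R : ℝ, ∀ p : ℂ, R < ‖p‖ → p ∉ tri f g h ∧ wt f g h p = 0 := by
  obtain ⟨R, hR⟩ := T.compact.isBounded.exists_norm_le
  refine ⟨R, fun p hp => ⟨fun h => absurd (hR p h) hp.not_ge, ?_⟩⟩
  have hf := ell_far T.cf (p := p) (fun t ht => (hR _ (Or.inl (Or.inl (mem_im ht)))).trans_lt hp)
  have hg := ell_far T.cg (p := p) (fun t ht => (hR _ (Or.inl (Or.inr (mem_im ht)))).trans_lt hp)
  have hh := ell_far T.ch (p := p) (fun t ht => (hR _ (Or.inr (mem_im ht))).trans_lt hp)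
  have : ell f p + ell g p + ell h p = 0 := by
    rw [hf, hg, hh, T.efg, T.egh, T.ehf]; ring
  have := congrArg Complex.im this
  simp only [Complex.add_im, Complex.zero_im] at this
  unfold wt θ
  rw [← add_div, ← add_div, this, zero_div]

lemma wt_unbdd (T : IsTri f g h) {S : Set ℂ} (hS : IsPreconnected S)
    (hd : S ⊆ (tri f g h)ᶜ) (hb : ¬ Bornology.IsBounded S) {p : ℂ} (hp : p ∈ S) :
    wt f g h p = 0 := by
  obtain ⟨R, hR⟩ := T.wt_far
  have : ∃ q ∈ S, R < ‖q‖ := by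
    by_contra hcon
    push Not at hcon
    exact hb (isBounded_iff_forall_norm_le.2 ⟨R, hcon⟩)
  obtain ⟨q, hq, hqR⟩ := this
  rw [T.wt_const hS hd hp hq, (hR q hqR).2]

/-- lift in arc form -/
lemma arc_log {f : ℝ → ℂ} (cf : ContinuousOn f (Icc 0 1)) (jf : InjOn f (Icc 0 1)) {p : ℂ}
    (hp : p ∉ im f) : ∃ G : ℂ → ℂ, ContinuousOn G (im f) ∧
      (∀ z ∈ im f, Complex.exp (G z) = z - p) ∧ G (f 1) - G (f 0) = ell f p := by
  obtain ⟨Γ, h1, h2, h3⟩ := exists_lift cf hp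
  obtain ⟨G, hG, hGe⟩ := arc_transfer cf jf h1
  refine ⟨G, hG, ?_, ?_⟩
  · rintro _ ⟨t, ht, rfl⟩
    rw [hGe t ht, h2 t ht]
  · rw [hGe _ o01, hGe _ z01, h3]

lemma arc_log2 {f : ℝ → ℂ} (cf : ContinuousOn f (Icc 0 1)) (jf : InjOn f (Icc 0 1)) {p q : ℂ}
    (hp : p ∉ im f) (hq : q ∉ im f) (k m : ℤ) : ∃ G : ℂ → ℂ, ContinuousOn G (im f) ∧
      (∀ z ∈ im f, Complex.exp (G z) = (z - p) ^ k * ((z - q) ^ m)⁻¹) ∧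
        G (f 1) - G (f 0) = k * ell f p - m * ell f q := by
  obtain ⟨G, h1, h2, h3⟩ := arc_log cf jf hp
  obtain ⟨H, h4, h5, h6⟩ := arc_log cf jf hq
  refine ⟨fun z => k * G z - m * H z, (continuousOn_const.mul h1).sub
    (continuousOn_const.mul h4), fun z hz => ?_, ?_⟩
  · rw [Complex.exp_sub, Complex.exp_int_mul, Complex.exp_int_mul, h2 z hz, h5 z hz,
      div_eq_mul_inv]
  · rw [← h3, ← h6]; ring

lemma tri_log (T : IsTri f g h) {p q : ℂ} (hp : p ∉ tri f g h) (hq : q ∉ tri f g h)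
    {k m : ℤ} (hw : k * wt f g h p = m * wt f g h q) :
    ∃ G : ℂ → ℂ, ContinuousOn G (tri f g h) ∧
      ∀ z ∈ tri f g h, Complex.exp (G z) * (z - q) ^ m = (z - p) ^ k := by
  obtain ⟨pf, pg, ph⟩ := nf hp
  obtain ⟨qf, qg, qh⟩ := nf hq
  obtain ⟨F, F1, F2, F3⟩ := arc_log2 T.cf T.jf pf qf k m
  obtain ⟨G, G1, G2, G3⟩ := arc_log2 T.cg T.jg pg qg k m
  obtain ⟨H, H1, H2, H3⟩ := arc_log2 T.ch T.jh ph qh k m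
  obtain ⟨x, hx, hx'⟩ := T.ell_int hp
  obtain ⟨y, hy, hy'⟩ := T.ell_int hq
  rw [hx', hy'] at hw
  have hw' : (k : ℂ) * x = m * y := by exact_mod_cast hw
  have c1 : Complex.exp (F (f 1) - G (f 1)) = 1 := by
    rw [Complex.exp_sub, F2 _ (mem_im o01), G2 _ (T.efg ▸ mem_im z01)]
    apply div_self
    rw [← F2 _ (mem_im o01)]; exact Complex.exp_ne_zero _
  have c2 : Complex.exp (G (g 1) - H (g 1)) = 1 := by
    rw [Complex.exp_sub, G2 _ (mem_im o01), H2 _ (T.egh ▸ mem_im z01)]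
    apply div_self
    rw [← G2 _ (mem_im o01)]; exact Complex.exp_ne_zero _
  obtain ⟨A, A1, A2, A3⟩ := glue (im_closed T.cf) (im_closed T.cg) F1
    (h := fun z => G z + (F (f 1) - G (f 1))) (G1.add continuousOn_const) (fun z a b => by
      have : z = f 1 := T.ifg ⟨a, b⟩
      rw [this]; ring)
  obtain ⟨B, B1, B2, B3⟩ := glue ((im_closed T.cf).union (im_closed T.cg)) (im_closed T.ch) A1
    (h := fun z => H z + ((F (f 1) - G (f 1)) + (G (g 1) - H (g 1))))
    (H1.add continuousOn_const) (by
      rintro z (a | a) b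
      · have : z = f 0 := by rw [← T.ehf]; exact T.ihf ⟨b, a⟩
        subst this
        rw [A2 _ a]
        rw [T.ehf, ← T.egh] at H3
        rw [← T.efg] at G3
        have e1 : (k : ℂ) * (ell f p + ell g p + ell h p) -
          m * (ell f q + ell g q + ell h q) = 0 := by
          rw [hx, hy]; linear_combination (2 * Real.pi * Complex.I) * hw'
        linear_combination -F3 - G3 - H3 - e1
      · have : z = g 1 := T.igh ⟨a, b⟩
        subst this
        rw [A3 _ a]; ring)
  refine ⟨B, B1, fun z hz => ?_⟩
  have hzq : (z - q) ^ m ≠ 0 := zpow_ne_zero _ (fun h0 => hq (by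
    rw [← sub_eq_zero.1 h0]; exact hz))
  have key : Complex.exp (B z) = (z - p) ^ k * ((z - q) ^ m)⁻¹ := by
    rcases hz with (hz | hz) | hz
    · rw [B2 z (Or.inl hz), A2 z hz, F2 z hz]
    · rw [B2 z (Or.inr hz), A3 z hz, Complex.exp_add, c1, G2 z hz, mul_one]
    · rw [B3 z hz, Complex.exp_add, Complex.exp_add, c1, c2, H2 z hz, mul_one, mul_one]
  rw [key, mul_assoc, inv_mul_cancel₀ hzq, mul_one]

lemma comp_open (T : IsTri f g h) (p : ℂ) : IsOpen (connectedComponentIn (tri f g h)ᶜ p) :=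
  T.isClosed.isOpen_compl.connectedComponentIn

lemma closure_comp {K : Set ℂ} (hK : IsClosed K) (p : ℂ) :
    closure (connectedComponentIn Kᶜ p) ⊆ connectedComponentIn Kᶜ p ∪ K := by
  intro z hz
  by_cases hzK : z ∈ K
  · exact Or.inr hzK
  · left
    have hzo : IsOpen (connectedComponentIn Kᶜ z) := hK.isOpen_compl.connectedComponentIn
    obtain ⟨y, hy1, hy2⟩ := mem_closure_iff.1 hz _ hzo (mem_connectedComponentIn hzK)
    rw [connectedComponentIn_eq hy2, ← connectedComponentIn_eq hy1]
    exact mem_connectedComponentIn hzK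

lemma frontier_comp {K : Set ℂ} (hK : IsClosed K) (p : ℂ) :
    frontier (connectedComponentIn Kᶜ p) ⊆ K := by
  rw [(hK.isOpen_compl.connectedComponentIn).frontier_eq]
  rintro z ⟨h1, h2⟩
  exact (closure_comp hK p h1).resolve_left h2

lemma unbdd_of_wt (T : IsTri f g h) {p : ℂ} (hp : p ∉ tri f g h) (hw : wt f g h p = 0) :
    ¬ Bornology.IsBounded (connectedComponentIn (tri f g h)ᶜ p) := by
  intro hb
  obtain ⟨G, G1, G2⟩ := T.tri_log hp hp (k := 1) (m := 0) (by simp [hw])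
  have := eilenberg (T.comp_open p) hb (mem_connectedComponentIn hp) (k := 1)
    (φ := fun _ => 1) continuousOn_const (fun _ _ => one_ne_zero)
    (G1.mono (frontier_comp T.isClosed p)) (fun z hz => by
      simpa using G2 z (frontier_comp T.isClosed p hz))
  exact one_ne_zero this

lemma bdd_of_wt (T : IsTri f g h) {p : ℂ} (hp : p ∉ tri f g h) (hw : wt f g h p ≠ 0) :
    Bornology.IsBounded (connectedComponentIn (tri f g h)ᶜ p) := by
  by_contra hb
  exact hw (T.wt_unbdd isPreconnected_connectedComponentIn (connectedComponentIn_subset _ _) hb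
    (mem_connectedComponentIn hp))

lemma wt_inside (T : IsTri f g h) {p q : ℂ} (hp : p ∉ tri f g h) (hq : q ∉ tri f g h)
    (wp : wt f g h p ≠ 0) (wq : wt f g h q ≠ 0) :
    q ∈ connectedComponentIn (tri f g h)ᶜ p ∧ wt f g h q = wt f g h p := by
  have h1 : q ∈ connectedComponentIn (tri f g h)ᶜ p := by
    by_contra hcon
    obtain ⟨m, -, hm⟩ := T.ell_int hp
    obtain ⟨k, -, hk⟩ := T.ell_int hq
    obtain ⟨G, G1, G2⟩ := T.tri_log hp hq (k := k) (m := m) (by rw [hm, hk]; ring)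
    have hne : ∀ z ∈ closure (connectedComponentIn (tri f g h)ᶜ p), z - q ≠ 0 := by
      intro z hz h0
      rw [sub_eq_zero.1 h0] at hz
      rcases closure_comp T.isClosed p hz with h | h
      · exact hcon h
      · exact hq h
    have := eilenberg (T.comp_open p) (T.bdd_of_wt hp wp) (mem_connectedComponentIn hp) (k := k)
      (φ := fun z => (z - q) ^ m)
      (fun z hz => ((continuousAt_id.sub continuousAt_const).zpow₀ m
          (Or.inl (hne z hz))).continuousWithinAt)
      (fun z hz => zpow_ne_zero _ (hne z hz))
      (G1.mono (frontier_comp T.isClosed p)) (fun z hz => G2 z (frontier_comp T.isClosed p hz))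
    apply wq; rw [hk, this]; simp
  exact ⟨h1, T.wt_const isPreconnected_connectedComponentIn (connectedComponentIn_subset _ _) h1
    (mem_connectedComponentIn hp)⟩

lemma exists_inside (T : IsTri f g h) : ∃ p, p ∉ tri f g h ∧ wt f g h p ≠ 0 := by
  classical
  by_contra hcon
  push Not at hcon
  have hz : ∀ p ∉ tri f g h, ell f p = -(ell g p + ell h p) := by
    intro p hp
    obtain ⟨m, h1, h2⟩ := T.ell_int hp
    rw [hcon p hp] at h2
    have : m = 0 := by exact_mod_cast h2.symm
    rw [this] at h1
    simp only [Int.cast_zero, zero_mul] at h1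
    linear_combination h1
  have hab : f 0 ≠ f 1 := fun e => zero_ne_one (T.jf z01 o01 e)
  let L : ℂ → ℂ := fun z => if z ∈ im f then -(ell g z + ell h z) else ell f z
  have hL1 : EqOn L (ell f) (im f)ᶜ := fun z hz => if_neg hz
  have hL2 : EqOn L (fun z => -(ell g z + ell h z)) (im g ∪ im h)ᶜ := by
    intro z hzz
    by_cases hf : z ∈ im f
    · simp only [L, hf, if_true]
    · simp only [L, hf, if_false]
      exact hz z (by rintro ((h | h) | h); exacts [hf h, hzz (Or.inl h), hzz (Or.inr h)])
  have hcont : ContinuousOn L ((im f)ᶜ ∪ (im g ∪ im h)ᶜ) := by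
    refine ContinuousOn.union_of_isOpen ?_ ?_ (im_closed T.cf).isOpen_compl
      ((im_closed T.cg).union (im_closed T.ch)).isOpen_compl
    · exact ContinuousOn.congr
        (fun z hz => (ell_continuousAt T.cf hz).continuousWithinAt) hL1
    · refine ContinuousOn.congr (fun z hz => ?_) hL2
      exact ((ell_continuousAt T.cg fun h => hz (Or.inl h)).add
        (ell_continuousAt T.ch fun h => hz (Or.inr h))).neg.continuousWithinAt
  have hexp : ∀ z ∈ (im f)ᶜ ∪ (im g ∪ im h)ᶜ,
      Complex.exp (L z) = (f 1 - z) / (f 0 - z) := by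
    rintro z (hz | hz)
    · rw [hL1 hz, exp_ell T.cf hz]
    · have zg : z ∉ im g := fun h => hz (Or.inl h)
      have zh : z ∉ im h := fun h => hz (Or.inr h)
      rw [hL2 hz, Complex.exp_neg, Complex.exp_add, exp_ell T.cg zg, exp_ell T.ch zh, T.efg,
        ← T.ehf, T.egh]
      have a := sub_ne zg 0 z01
      have b := sub_ne zh 0 z01
      have c := sub_ne zh 1 o01
      field_simp
  have hpos : 0 < ‖f 1 - f 0‖ := norm_pos_iff.2 (sub_ne_zero.2 hab.symm)
  have hdom : ∀ z, z ≠ f 0 → z ≠ f 1 → z ∈ (im f)ᶜ ∪ (im g ∪ im h)ᶜ := by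
    intro z z0 z1
    by_contra hc
    have a : z ∈ im f := not_not.1 fun h => hc (Or.inl h)
    have b' : z ∈ im g ∪ im h := not_not.1 fun h => hc (Or.inr h)
    rcases b' with b | b
    · exact z1 (T.ifg ⟨a, b⟩)
    · exact z0 (by rw [← T.ehf]; exact T.ihf ⟨b, a⟩)
  have hsp : ∀ z ∈ Metric.sphere (f 0) (‖f 1 - f 0‖ / 2), ‖z - f 0‖ = ‖f 1 - f 0‖ / 2 :=
    fun z hz => by simpa [dist_eq_norm] using hz
  have hs0 : ∀ z ∈ Metric.sphere (f 0) (‖f 1 - f 0‖ / 2), z ≠ f 0 := fun z hz e => by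
    have := hsp z hz; rw [e, sub_self, norm_zero] at this; linarith
  have hs1 : ∀ z ∈ Metric.sphere (f 0) (‖f 1 - f 0‖ / 2), z ≠ f 1 := fun z hz e => by
    have := hsp z hz; rw [e] at this; linarith
  have hsl : ∀ z ∈ Metric.sphere (f 0) (‖f 1 - f 0‖ / 2),
      1 - (z - f 0) / (f 1 - f 0) ∈ Complex.slitPlane := fun z hz => by
    apply slit_of
    rw [norm_div, hsp z hz, div_lt_one hpos]; linarith
  have := circle_log (p := f 0) (R := ‖f 1 - f 0‖ / 2) (by linarith) (k := 1)
    (g := fun z => Complex.log (1 - (z - f 0) / (f 1 - f 0)) + Complex.log (-(f 1 - f 0)) - L z)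
    (by
      refine ((ContinuousOn.clog ?_ hsl).add continuousOn_const).sub
        (hcont.mono fun z hz => hdom z (hs0 z hz) (hs1 z hz))
      fun_prop)
    (fun z hz => by
      have n1 : f 1 - f 0 ≠ 0 := sub_ne_zero.2 hab.symm
      have n2 : f 1 - z ≠ 0 := sub_ne_zero.2 (hs1 z hz).symm
      have n3 : f 0 - z ≠ 0 := sub_ne_zero.2 (hs0 z hz).symm
      rw [Complex.exp_sub, Complex.exp_add, hexp z (hdom z (hs0 z hz) (hs1 z hz)),
        Complex.exp_log (Complex.slitPlane_ne_zero (hsl z hz)), Complex.exp_log (neg_ne_zero.2 n1)]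
      field_simp
      ring)
  exact one_ne_zero this

lemma frontier_aux (T : IsTri f g h) {U : Set ℂ} (hU : IsOpen U) (hb : Bornology.IsBounded U)
    (hfr : frontier U ⊆ tri f g h) {p : ℂ} (hp : p ∈ U) (hpC : p ∉ tri f g h) {t : ℝ}
    (ht0 : 0 < t) (ht1 : t < 1) : f t ∈ frontier U := by
  by_contra hcon
  have hct : ContinuousAt f t := T.cf.continuousAt (Icc_mem_nhds ht0 ht1)
  have hev : ∀ᶠ s in 𝓝 t, f s ∉ frontier U :=
    hct.eventually (isClosed_frontier.isOpen_compl.mem_nhds hcon)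
  obtain ⟨ε, hε, hball⟩ := Metric.eventually_nhds_iff.1 hev
  set δ := min (ε / 2) (min t (1 - t)) with hδ
  have d1 : δ ≤ ε / 2 := min_le_left _ _
  have d2 : δ ≤ t := (min_le_right _ _).trans (min_le_left _ _)
  have d3 : δ ≤ 1 - t := (min_le_right _ _).trans (min_le_right _ _)
  have d0 : 0 < δ := lt_min (by linarith) (lt_min ht0 (by linarith))
  have hgood : ∀ s, t - δ ≤ s → s ≤ t + δ → f s ∉ frontier U := by
    intro s h1 h2
    apply hball
    rw [Real.dist_eq, abs_lt]; constructor <;> linarith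
  have s1 : Icc 0 (t - δ) ⊆ Icc (0 : ℝ) 1 := Icc_subset_Icc_right (by linarith)
  have s2 : Icc (t + δ) 1 ⊆ Icc (0 : ℝ) 1 := Icc_subset_Icc_left (by linarith)
  obtain ⟨pf, pg, ph⟩ := nf hpC
  have l1 : HasLog (fun z => z - p) (f '' Icc 0 (t - δ)) :=
    hasLog_arc (by linarith) (T.cf.mono s1) (T.jf.mono s1) (fun h => pf (image_mono s1 h))
  have l2 : HasLog (fun z => z - p) (f '' Icc (t + δ) 1) :=
    hasLog_arc (by linarith) (T.cf.mono s2) (T.jf.mono s2) (fun h => pf (image_mono s2 h))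
  have lg : HasLog (fun z => z - p) (im g) := hasLog_arc zero_le_one T.cg T.jg pg
  have lh : HasLog (fun z => z - p) (im h) := hasLog_arc zero_le_one T.ch T.jh ph
  have k1 : IsClosed (f '' Icc 0 (t - δ)) :=
    (isCompact_Icc.image_of_continuousOn (T.cf.mono s1)).isClosed
  have k2 : IsClosed (f '' Icc (t + δ) 1) :=
    (isCompact_Icc.image_of_continuousOn (T.cf.mono s2)).isClosed
  have n1 : ∀ s ∈ Icc 0 (t - δ), f s ≠ f 1 := fun s hs e => by
    have := T.jf (s1 hs) o01 e
    have := hs.2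
    linarith
  have n2 : ∀ s ∈ Icc (t + δ) 1, f s ≠ f 0 := fun s hs e => by
    have := T.jf (s2 hs) z01 e
    have := hs.1
    linarith
  have m1 := HasLog.union k1 (im_closed T.ch) l1 lh (z₀ := h 1) (fun z hz =>
    T.ihf ⟨hz.2, image_mono s1 hz.1⟩)
  have m2 := HasLog.union (k1.union (im_closed T.ch)) (im_closed T.cg) m1 lg (z₀ := g 1) (by
    rintro z ⟨⟨s, hs, rfl⟩ | h1, h2⟩
    · exact absurd (T.ifg ⟨mem_im (s1 hs), h2⟩) (n1 s hs)
    · exact T.igh ⟨h2, h1⟩)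
  have m3 := HasLog.union ((k1.union (im_closed T.ch)).union (im_closed T.cg)) k2 m2 l2
    (z₀ := f 1) (by
    rintro z ⟨(⟨s, hs, rfl⟩ | h1) | h1, ⟨s', hs', e⟩⟩
    · have := T.jf (s2 hs') (s1 hs) e
      have := hs.2
      have := hs'.1
      linarith
    · subst e
      have : f s' = h 1 := T.ihf ⟨h1, mem_im (s2 hs')⟩
      exact absurd (this.trans T.ehf) (n2 s' hs')
    · subst e
      exact T.ifg ⟨mem_im (s2 hs'), h1⟩)
  obtain ⟨G, G1, G2⟩ := m3.mono (L := frontier U) (by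
    intro z hz
    rcases hfr hz with (⟨s, hs, rfl⟩ | h1) | h1
    · by_cases a1 : s ≤ t - δ
      · exact Or.inl (Or.inl (Or.inl ⟨s, ⟨hs.1, a1⟩, rfl⟩))
      · by_cases a2 : t + δ ≤ s
        · exact Or.inr ⟨s, ⟨a2, hs.2⟩, rfl⟩
        · exact absurd hz (hgood s (by linarith) (by linarith))
    · exact Or.inl (Or.inr h1)
    · exact Or.inl (Or.inl (Or.inr h1)))
  have := eilenberg hU hb hp (k := 1) (φ := fun _ => 1) continuousOn_const
    (fun _ _ => one_ne_zero) G1 (fun z hz => by simpa using G2 z hz)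
  exact one_ne_zero this

/-- the inside -/
def Ins (f g h : ℝ → ℂ) : Set ℂ := {p | p ∉ tri f g h ∧ wt f g h p ≠ 0}
/-- the outside -/
def Out (f g h : ℝ → ℂ) : Set ℂ := {p | p ∉ tri f g h ∧ wt f g h p = 0}

lemma Ins_open (T : IsTri f g h) : IsOpen (Ins f g h) := by
  rw [isOpen_iff_mem_nhds]
  intro p hp
  filter_upwards [T.wt_near hp.1] with q hq
  exact ⟨hq.1, by rw [hq.2]; exact hp.2⟩

lemma Out_open (T : IsTri f g h) : IsOpen (Out f g h) := by
  rw [isOpen_iff_mem_nhds]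
  intro p hp
  filter_upwards [T.wt_near hp.1] with q hq
  exact ⟨hq.1, by rw [hq.2]; exact hp.2⟩

lemma Ins_bdd (T : IsTri f g h) : Bornology.IsBounded (Ins f g h) := by
  obtain ⟨R, hR⟩ := T.wt_far
  refine isBounded_iff_forall_norm_le.2 ⟨R, fun p hp => ?_⟩
  by_contra hlt
  exact hp.2 (hR p (not_le.1 hlt)).2

lemma frontier_Ins (T : IsTri f g h) : frontier (Ins f g h) ⊆ tri f g h := by
  rw [T.Ins_open.frontier_eq]
  rintro z ⟨h1, h2⟩
  by_contra hz
  have : z ∈ Out f g h := ⟨hz, not_not.1 fun h => h2 ⟨hz, h⟩⟩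
  obtain ⟨y, hy, hy'⟩ := mem_closure_iff.1 h1 _ T.Out_open this
  exact hy'.2 hy.2

lemma frontier_Out (T : IsTri f g h) : frontier (Out f g h) ⊆ tri f g h := by
  rw [T.Out_open.frontier_eq]
  rintro z ⟨h1, h2⟩
  by_contra hz
  have : z ∈ Ins f g h := ⟨hz, fun h => h2 ⟨hz, h⟩⟩
  obtain ⟨y, hy, hy'⟩ := mem_closure_iff.1 h1 _ T.Ins_open this
  exact hy.2 hy'.2

lemma im_subset_closure {f : ℝ → ℂ} (cf : ContinuousOn f (Icc 0 1)) {S : Set ℂ}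
    (hS : IsClosed S) (h : ∀ t, 0 < t → t < 1 → f t ∈ S) : im f ⊆ S := by
  rintro _ ⟨t, ht, rfl⟩
  have h1 : t ∈ closure (Ioo (0 : ℝ) 1) := by rw [closure_Ioo zero_ne_one]; exact ht
  have h2 : ContinuousOn f (closure (Ioo (0 : ℝ) 1)) := by
    rw [closure_Ioo zero_ne_one]; exact cf
  have := h2.image_closure ⟨t, h1, rfl⟩
  refine closure_minimal ?_ hS this
  rintro _ ⟨s, hs, rfl⟩
  exact h s hs.1 hs.2

lemma im_Ins (T : IsTri f g h) : im f ⊆ closure (Ins f g h) := by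
  obtain ⟨p, hp1, hp2⟩ := T.exists_inside
  exact im_subset_closure T.cf isClosed_closure fun t h0 h1 =>
    frontier_subset_closure
      (T.frontier_aux T.Ins_open T.Ins_bdd T.frontier_Ins ⟨hp1, hp2⟩ hp1 h0 h1)

lemma im_Out (T : IsTri f g h) : im f ⊆ closure (Out f g h) := by
  obtain ⟨p, hp1, hp2⟩ := T.exists_inside
  have hfr : frontier (closure (Out f g h))ᶜ ⊆ frontier (Out f g h) := by
    rw [frontier_compl]; exact frontier_closure_subset
  have hb : Bornology.IsBounded (closure (Out f g h))ᶜ := by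
    obtain ⟨R, hR⟩ := T.wt_far
    refine isBounded_iff_forall_norm_le.2 ⟨R, fun p hp => ?_⟩
    by_contra hlt
    exact hp (subset_closure (hR p (not_le.1 hlt)))
  refine im_subset_closure T.cf isClosed_closure fun t h0 h1 =>
    frontier_subset_closure (hfr (T.frontier_aux isClosed_closure.isOpen_compl hb
      (hfr.trans T.frontier_Out) (p := p) ?_ hp1 h0 h1))
  intro hc
  obtain ⟨y, hy, hy'⟩ := mem_closure_iff.1 hc _ T.Ins_open ⟨hp1, hp2⟩
  exact hy.2 hy'.2

lemma Ins_rot (f g h : ℝ → ℂ) : Ins g h f = Ins f g h := by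
  unfold Ins; ext p; rw [tri_rot, mem_setOf, wt_rot]; rfl

lemma Out_rot (f g h : ℝ → ℂ) : Out g h f = Out f g h := by
  unfold Out; ext p; rw [tri_rot, mem_setOf, wt_rot]; rfl

lemma tri_Ins (T : IsTri f g h) : tri f g h ⊆ closure (Ins f g h) := by
  rintro z ((hz | hz) | hz)
  · exact T.im_Ins hz
  · rw [← Ins_rot]; exact T.rot.im_Ins hz
  · rw [← Ins_rot, ← Ins_rot]; exact T.rot.rot.im_Ins hz

lemma tri_Out (T : IsTri f g h) : tri f g h ⊆ closure (Out f g h) := by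
  rintro z ((hz | hz) | hz)
  · exact T.im_Out hz
  · rw [← Out_rot]; exact T.rot.im_Out hz
  · rw [← Out_rot, ← Out_rot]; exact T.rot.rot.im_Out hz

end IsTri
end IVO

namespace IVO

structure PD (n : ℕ) where
  vtx : Fin n → ℂ
  f : Fin n → Fin n → ℝ → ℂ
  cont : ∀ u v, u ≠ v → ContinuousOn (f u v) (Icc 0 1)
  inj : ∀ u v, u ≠ v → InjOn (f u v) (Icc 0 1)
  f0 : ∀ u v, u ≠ v → f u v 0 = vtx u
  f1 : ∀ u v, u ≠ v → f u v 1 = vtx v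
  rev : ∀ u v, u ≠ v → f v u = fun t => f u v (1 - t)
  vinj : Function.Injective vtx
  vnot : ∀ u v w, u ≠ v → w ≠ u → w ≠ v → vtx w ∉ im (f u v)
  adj : ∀ u v w, u ≠ v → u ≠ w → v ≠ w → im (f u v) ∩ im (f u w) ⊆ {vtx u}
  cr : ∀ u v x y, u ≠ v → x ≠ y → u ≠ x → u ≠ y → v ≠ x → v ≠ y →
    ∀ r ∈ im (f u v) ∩ im (f x y), im (f u v) ∩ im (f x y) ⊆ {r} ∧
      CrossesAt (im (f u v)) (im (f x y)) r
  conv : ∀ a b c x, a ≠ b → b ≠ c → c ≠ a → x ≠ a → x ≠ b → x ≠ c →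
    wt (f a b) (f b c) (f c a) (vtx x) ≠ 0 → ∀ p ∈ im (f x a),
      p ∉ tri (f a b) (f b c) (f c a) → wt (f a b) (f b c) (f c a) p ≠ 0

namespace PD

variable {n : ℕ} (P : PD n)

/-- edge arcs -/
def A (u v : Fin n) : Set ℂ := im (P.f u v)

/-- triangles -/
def tr (a b c : Fin n) : Set ℂ := tri (P.f a b) (P.f b c) (P.f c a)

/-- winding numbers -/
def W (a b c : Fin n) (p : ℂ) : ℝ := wt (P.f a b) (P.f b c) (P.f c a) p

variable {P} {a b c u v w x y : Fin n} {p q r : ℂ}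

lemma A_symm (h : u ≠ v) : P.A u v = P.A v u := by
  unfold A im
  rw [P.rev u v h]
  ext z
  constructor
  · rintro ⟨t, ht, rfl⟩
    exact ⟨1 - t, ⟨by linarith [ht.2], by linarith [ht.1]⟩, by simp⟩
  · rintro ⟨t, ht, rfl⟩
    exact ⟨1 - t, ⟨by linarith [ht.2], by linarith [ht.1]⟩, rfl⟩

lemma A_closed (h : u ≠ v) : IsClosed (P.A u v) := im_closed (P.cont u v h)

lemma vl (h : u ≠ v) : P.vtx u ∈ P.A u v := by
  rw [← P.f0 u v h]; exact mem_im z01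

lemma vr (h : u ≠ v) : P.vtx v ∈ P.A u v := by
  rw [← P.f1 u v h]; exact mem_im o01

lemma adj' (h1 : u ≠ v) (h2 : u ≠ w) (h3 : v ≠ w) (hp : p ∈ P.A u v) (hq : p ∈ P.A u w) :
    p = P.vtx u := P.adj u v w h1 h2 h3 ⟨hp, hq⟩

lemma T (hab : a ≠ b) (hbc : b ≠ c) (hca : c ≠ a) : IsTri (P.f a b) (P.f b c) (P.f c a) where
  cf := P.cont a b hab
  cg := P.cont b c hbc
  ch := P.cont c a hca
  jf := P.inj a b hab
  jg := P.inj b c hbc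
  jh := P.inj c a hca
  efg := by rw [P.f1 a b hab, P.f0 b c hbc]
  egh := by rw [P.f1 b c hbc, P.f0 c a hca]
  ehf := by rw [P.f1 c a hca, P.f0 a b hab]
  ifg := by
    rintro z ⟨h1, h2⟩
    rw [P.f1 a b hab]
    change z ∈ P.A a b at h1
    rw [A_symm hab] at h1
    exact adj' hab.symm hbc hca.symm h1 h2
  igh := by
    rintro z ⟨h1, h2⟩
    rw [P.f1 b c hbc]
    change z ∈ P.A b c at h1
    rw [A_symm hbc] at h1
    exact adj' hbc.symm hca hab.symm h1 h2
  ihf := by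
    rintro z ⟨h1, h2⟩
    rw [P.f1 c a hca]
    change z ∈ P.A c a at h1
    rw [A_symm hca] at h1
    exact adj' hca.symm hab hbc.symm h1 h2

lemma tr_eq : P.tr a b c = P.A a b ∪ P.A b c ∪ P.A c a := rfl

lemma nmem_tr : p ∉ P.tr a b c ↔ p ∉ P.A a b ∧ p ∉ P.A b c ∧ p ∉ P.A c a := by
  rw [tr_eq]; simp only [mem_union]; tauto

lemma tr_rot : P.tr b c a = P.tr a b c := by
  rw [tr_eq, tr_eq]; ext z; simp only [mem_union]; tauto

lemma tr_swap (hab : a ≠ b) (hbc : b ≠ c) (hca : c ≠ a) : P.tr b a c = P.tr a b c := by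
  rw [tr_eq, tr_eq, A_symm hab.symm, A_symm hca.symm, A_symm hbc.symm]
  ext z; simp only [mem_union]; tauto

lemma W_rot : P.W b c a p = P.W a b c p := wt_rot _ _ _ _

lemma th_rev (h : u ≠ v) (hp : p ∉ P.A u v) : θ (P.f v u) p = - θ (P.f u v) p := by
  rw [P.rev u v h]
  exact θ_rev (P.cont u v h) hp

lemma W_swap (hab : a ≠ b) (hbc : b ≠ c) (hca : c ≠ a) (hp : p ∉ P.tr a b c) :
    P.W b a c p = - P.W a b c p := by
  obtain ⟨h1, h2, h3⟩ := nmem_tr.1 hp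
  unfold W wt
  rw [th_rev hab h1, th_rev hca h3, th_rev hbc h2]
  ring

lemma cocycle (h1 : x ≠ a) (h2 : x ≠ b) (h3 : x ≠ c)
    (p1 : p ∉ P.A x a) (p2 : p ∉ P.A x b) (p3 : p ∉ P.A x c) :
    P.W a b c p = P.W x a b p + P.W x b c p + P.W x c a p := by
  unfold W wt
  rw [th_rev h1 p1, th_rev h2 p2, th_rev h3 p3]
  ring

lemma W_near (hab : a ≠ b) (hbc : b ≠ c) (hca : c ≠ a) (hq : q ∉ P.tr a b c) :
    ∀ᶠ p in 𝓝 q, p ∉ P.tr a b c ∧ P.W a b c p = P.W a b c q := (T hab hbc hca).wt_near hq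

/-- the signed value inside -/
def k (P : PD n) (a b c : Fin n) : ℝ := by
  classical
  exact if h : ∃ p, p ∉ P.tr a b c ∧ P.W a b c p ≠ 0 then P.W a b c h.choose else 0

lemma k_eq (hab : a ≠ b) (hbc : b ≠ c) (hca : c ≠ a) (hp : p ∉ P.tr a b c)
    (hw : P.W a b c p ≠ 0) : P.W a b c p = P.k a b c := by
  have h : ∃ p, p ∉ P.tr a b c ∧ P.W a b c p ≠ 0 := ⟨p, hp, hw⟩
  rw [k, dif_pos h]
  exact ((T hab hbc hca).wt_inside h.choose_spec.1 hp h.choose_spec.2 hw).2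

lemma ex_in (hab : a ≠ b) (hbc : b ≠ c) (hca : c ≠ a) :
    ∃ p, p ∉ P.tr a b c ∧ P.W a b c p ≠ 0 := (T hab hbc hca).exists_inside

lemma k_ne (hab : a ≠ b) (hbc : b ≠ c) (hca : c ≠ a) : P.k a b c ≠ 0 := by
  obtain ⟨p, hp, hw⟩ := ex_in (P := P) hab hbc hca
  rwa [← k_eq hab hbc hca hp hw]

lemma W_cases (hab : a ≠ b) (hbc : b ≠ c) (hca : c ≠ a) (hp : p ∉ P.tr a b c) :
    P.W a b c p = 0 ∨ P.W a b c p = P.k a b c := by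
  by_cases h : P.W a b c p = 0
  · exact Or.inl h
  · exact Or.inr (k_eq hab hbc hca hp h)

lemma k_rot (hab : a ≠ b) (hbc : b ≠ c) (hca : c ≠ a) : P.k b c a = P.k a b c := by
  obtain ⟨p, hp, hw⟩ := ex_in (P := P) hab hbc hca
  rw [← k_eq hab hbc hca hp hw, ← W_rot]
  rw [← W_rot] at hw
  rw [← tr_rot] at hp
  exact (k_eq hbc hca hab hp hw).symm

lemma k_swap (hab : a ≠ b) (hbc : b ≠ c) (hca : c ≠ a) : P.k b a c = - P.k a b c := by
  obtain ⟨p, hp, hw⟩ := ex_in (P := P) hab hbc hca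
  have e := W_swap hab hbc hca hp
  rw [← k_eq hab hbc hca hp hw, ← e]
  refine (k_eq hab.symm hca.symm hbc.symm ?_ ?_).symm
  · rwa [tr_swap hab hbc hca]
  · rw [e]; exact neg_ne_zero.2 hw

lemma W_far : ∃ R : ℝ, ∀ p : ℂ, R < ‖p‖ → ∀ a b c : Fin n, a ≠ b → b ≠ c → c ≠ a →
    p ∉ P.tr a b c ∧ P.W a b c p = 0 := by
  have : ∀ t : Fin n × Fin n × Fin n, ∃ R : ℝ, ∀ p : ℂ, R < ‖p‖ →
      t.1 ≠ t.2.1 → t.2.1 ≠ t.2.2 → t.2.2 ≠ t.1 →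
      p ∉ P.tr t.1 t.2.1 t.2.2 ∧ P.W t.1 t.2.1 t.2.2 p = 0 := by
    rintro ⟨a, b, c⟩
    by_cases h : a ≠ b ∧ b ≠ c ∧ c ≠ a
    · obtain ⟨R, hR⟩ := (T (P := P) h.1 h.2.1 h.2.2).wt_far
      exact ⟨R, fun p hp _ _ _ => hR p hp⟩
    · exact ⟨0, fun p hp h1 h2 h3 => absurd ⟨h1, h2, h3⟩ h⟩
  choose R hR using this
  refine ⟨∑ t, |R t|, fun p hp a b c h1 h2 h3 => hR (a, b, c) p (lt_of_le_of_lt ?_ hp) h1 h2 h3⟩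
  exact (le_abs_self _).trans
    (Finset.single_le_sum (f := fun t => |R t|) (fun _ _ => abs_nonneg _) (Finset.mem_univ _))

/-- density of the complement of an arc -/
lemma dense_compl (hn : 3 ≤ n) (h : u ≠ v) : Dense (P.A u v)ᶜ := by
  have : ∃ w : Fin n, w ≠ u ∧ w ≠ v := by
    by_contra hc
    push Not at hc
    have : (Finset.univ : Finset (Fin n)) ⊆ {u, v} := by
      intro w _
      by_cases hw : w = u
      · simp [hw]
      · simp [hc w hw]
    have := Finset.card_le_card this
    have h2 := Finset.card_le_two (a := u) (b := v)
    simp at this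
    omega
  obtain ⟨w, hu, hv⟩ := this
  intro z
  by_cases hz : z ∈ P.A u v
  · have := (T (P := P) h hv.symm hu).tri_Out (Or.inl (Or.inl hz))
    refine closure_mono ?_ this
    intro q hq hq2
    exact hq.1 (Or.inl (Or.inl hq2))
  · exact subset_closure hz

/-- All arcs -/
def AA (P : PD n) : Set ℂ := ⋃ u, ⋃ v, ⋃ (_ : u ≠ v), P.A u v

lemma mem_AA : p ∈ P.AA ↔ ∃ u v, u ≠ v ∧ p ∈ P.A u v := by
  simp [AA]

lemma AA_closed : IsClosed P.AA := by
  unfold AA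
  refine isClosed_iUnion_of_finite fun u => isClosed_iUnion_of_finite fun v =>
    isClosed_iUnion_of_finite fun h => A_closed h

lemma dense_AA (hn : 3 ≤ n) : Dense P.AAᶜ := by
  have e : P.AAᶜ = ⋂ t : {t : Fin n × Fin n // t.1 ≠ t.2}, (P.A t.1.1 t.1.2)ᶜ := by
    ext z
    simp [mem_AA]
  rw [e]
  exact dense_iInter_of_isOpen (fun t => (A_closed t.2).isOpen_compl)
    (fun t => dense_compl hn t.2)

lemma off (h : p ∉ P.AA) (huv : u ≠ v) : p ∉ P.A u v := fun hh => h (mem_AA.2 ⟨u, v, huv, hh⟩)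

lemma off_tr (h : p ∉ P.AA) (hab : a ≠ b) (hbc : b ≠ c) (hca : c ≠ a) : p ∉ P.tr a b c :=
  nmem_tr.2 ⟨off h hab, off h hbc, off h hca⟩

lemma conv_a (hab : a ≠ b) (hbc : b ≠ c) (hca : c ≠ a) (xa : x ≠ a) (xb : x ≠ b) (xc : x ≠ c)
    (hw : P.W a b c (P.vtx x) ≠ 0) (hp : p ∈ P.A x a) (hq : p ∉ P.tr a b c) : P.W a b c p ≠ 0 :=
  P.conv a b c x hab hbc hca xa xb xc hw p hp hq

lemma conv_b (hab : a ≠ b) (hbc : b ≠ c) (hca : c ≠ a) (xa : x ≠ a) (xb : x ≠ b) (xc : x ≠ c)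
    (hw : P.W a b c (P.vtx x) ≠ 0) (hp : p ∈ P.A x b) (hq : p ∉ P.tr a b c) : P.W a b c p ≠ 0 := by
  rw [← W_rot] at hw ⊢
  rw [← tr_rot] at hq
  exact conv_a hbc hca hab xb xc xa hw hp hq

lemma conv_c (hab : a ≠ b) (hbc : b ≠ c) (hca : c ≠ a) (xa : x ≠ a) (xb : x ≠ b) (xc : x ≠ c)
    (hw : P.W a b c (P.vtx x) ≠ 0) (hp : p ∈ P.A x c) (hq : p ∉ P.tr a b c) : P.W a b c p ≠ 0 := by
  rw [← W_rot] at hw ⊢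
  rw [← tr_rot] at hq
  exact conv_b hbc hca hab xb xc xa hw hp hq

lemma S_out (hab : a ≠ b) (hbc : b ≠ c) (hca : c ≠ a) (xa : x ≠ a) (xb : x ≠ b) (xc : x ≠ c)
    (hw : P.W a b c (P.vtx x) ≠ 0) (hp : p ∉ P.tr a b c) (h0 : P.W a b c p = 0) :
    P.W a b x p = 0 := by
  have hu := (T hab hbc hca).unbdd_of_wt hp h0
  refine (T hab xb.symm xa).wt_unbdd (isPreconnected_connectedComponentIn
    (F := (P.tr a b c)ᶜ) (x := p)) ?_ hu (mem_connectedComponentIn hp)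
  intro q hq
  have hq1 : q ∉ P.tr a b c := connectedComponentIn_subset _ _ hq
  have hq0 : P.W a b c q = 0 := by
    rw [← h0]
    exact (T hab hbc hca).wt_const (isPreconnected_connectedComponentIn
      (F := (P.tr a b c)ᶜ) (x := p)) (connectedComponentIn_subset _ _) hq
      (mem_connectedComponentIn hp)
  refine nmem_tr.2 ⟨(nmem_tr.1 hq1).1, fun h => ?_, fun h => ?_⟩
  · rw [A_symm xb.symm] at h
    exact conv_b hab hbc hca xa xb xc hw h hq1 hq0
  · exact conv_a hab hbc hca xa xb xc hw h hq1 hq0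

lemma S (hab : a ≠ b) (hbc : b ≠ c) (hca : c ≠ a) (xa : x ≠ a) (xb : x ≠ b) (xc : x ≠ c)
    (hw : P.W a b c (P.vtx x) ≠ 0) : P.k a b x = P.k a b c := by
  have key : ∃ t : ℝ, 0 < t ∧ t < 1 ∧ P.f a b t ∉ P.A x c := by
    by_contra hc
    push Not at hc
    have h1 := hc (1/3) (by norm_num) (by norm_num)
    have h2 := hc (2/3) (by norm_num) (by norm_num)
    have m1 : (1/3 : ℝ) ∈ Icc (0 : ℝ) 1 := by constructor <;> norm_num
    have m2 : (2/3 : ℝ) ∈ Icc (0 : ℝ) 1 := by constructor <;> norm_num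
    have := (P.cr a b x c hab xc xa.symm hca.symm xb.symm hbc _ ⟨mem_im m1, h1⟩).1
      ⟨mem_im m2, h2⟩
    have := P.inj a b hab m2 m1 this
    norm_num at this
  obtain ⟨t, t0, t1, hxc⟩ := key
  set p0 := P.f a b t with hp0
  have mt : t ∈ Icc (0 : ℝ) 1 := ⟨t0.le, t1.le⟩
  have m0 : p0 ∈ P.A a b := mem_im mt
  have na : p0 ≠ P.vtx a := by
    rw [← P.f0 a b hab, hp0]
    intro h
    exact t0.ne' (P.inj a b hab mt z01 h)
  have nb : p0 ≠ P.vtx b := by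
    rw [← P.f1 a b hab, hp0]
    intro h
    exact t1.ne (P.inj a b hab mt o01 h)
  have m0' : p0 ∈ P.A b a := by rwa [A_symm hab.symm]
  have hbc' : p0 ∉ P.A b c := fun h => nb (adj' hab.symm hbc hca.symm m0' h)
  have hbx' : p0 ∉ P.A b x := fun h => nb (adj' hab.symm xb.symm xa.symm m0' h)
  have hac' : p0 ∉ P.A a c := fun h => na (adj' hab hca.symm hbc m0 h)
  have hax' : p0 ∉ P.A a x := fun h => na (adj' hab xa.symm xb.symm m0 h)
  have n1 : p0 ∉ P.tr b c x :=
    nmem_tr.2 ⟨hbc', by rwa [A_symm xc.symm], by rwa [A_symm xb]⟩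
  have n2 : p0 ∉ P.tr c a x :=
    nmem_tr.2 ⟨by rwa [A_symm hca], hax', hxc⟩
  have N1 := W_near hbc xc.symm xb n1
  have N2 := W_near hca xa.symm xc n2
  have hO : p0 ∈ closure (IsTri.Out (P.f a b) (P.f b c) (P.f c a)) :=
    (T hab hbc hca).tri_Out (Or.inl (Or.inl m0))
  have hI : p0 ∈ closure (IsTri.Ins (P.f a b) (P.f b c) (P.f c a)) :=
    (T hab hbc hca).tri_Ins (Or.inl (Or.inl m0))
  rw [mem_closure_iff_frequently] at hO hI
  have z : P.W b c x p0 = 0 ∧ P.W c a x p0 = 0 := by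
    obtain ⟨p, ⟨hp, hp0⟩, ⟨-, h1⟩, ⟨-, h2⟩⟩ := (hO.and_eventually (N1.and N2)).exists
    rw [← h1, ← h2]
    have hp0' : P.W a b c p = 0 := hp0
    constructor
    · exact S_out hbc hca hab xb xc xa (by rwa [W_rot]) (by rwa [tr_rot]) (by rwa [W_rot])
    · exact S_out hca hab hbc xc xa xb (by rwa [← W_rot]) (by rwa [← tr_rot]) (by rwa [← W_rot])
  obtain ⟨p, ⟨hp, hpw⟩, ⟨q1, h1⟩, ⟨q2, h2⟩⟩ := (hI.and_eventually (N1.and N2)).exists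
  change P.W a b c p ≠ 0 at hpw
  change p ∉ P.tr a b c at hp
  rw [nmem_tr] at q1 q2
  have co := cocycle (P := P) (p := p) xa xb xc (by rw [A_symm xa]; exact q2.2.1) q1.2.2
    (by exact q2.2.2)
  rw [← W_rot (a := x) (b := b), ← W_rot (a := x) (b := c), h1, h2, z.1, z.2, ← W_rot (a := x)] at co
  simp only [add_zero] at co
  rw [← k_eq hab hbc hca hp hpw, co]
  refine (k_eq hab xb.symm xa ?_ (co ▸ hpw)).symm
  exact nmem_tr.2 ⟨(nmem_tr.1 hp).1, by rw [A_symm xb.symm]; exact q1.2.2,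
    by rw [A_symm xa]; exact q2.2.1⟩

end PD
end IVO

namespace IVO
namespace PD

variable {n : ℕ} {P : PD n} {a b c u v w x y : Fin n} {p q r : ℂ}

lemma both (huv : u ≠ v) (hvw : v ≠ w) (hwu : w ≠ u) {γ : Set ℂ}
    (h1 : r ∉ P.A v w) (h2 : r ∉ P.A w u)
    (hc : CrossesAt (P.A u v) γ r) {N : Set ℂ} (hN : N ∈ 𝓝 r) :
    (∃ p ∈ γ ∩ N, p ∉ P.tr u v w ∧ P.W u v w p = 0) ∧
    (∃ p ∈ γ ∩ N, p ∉ P.tr u v w ∧ P.W u v w p ≠ 0) := by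
  have TT := T (P := P) huv hvw hwu
  obtain ⟨hr, -, hc⟩ := hc
  have m1 : (P.A v w)ᶜ ∈ 𝓝 r := (A_closed hvw).isOpen_compl.mem_nhds h1
  have m2 : (P.A w u)ᶜ ∈ 𝓝 r := (A_closed hwu).isOpen_compl.mem_nhds h2
  obtain ⟨V, hV, hVN, C1, C2, he, -, c1, c2, ⟨z1, g1, z1C⟩, ⟨z2, g2, z2C⟩⟩ :=
    hc _ (Filter.inter_mem hN (Filter.inter_mem m1 m2))
  have s1 : C1 ⊆ V \ P.A u v := by rw [he]; exact subset_union_left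
  have s2 : C2 ⊆ V \ P.A u v := by rw [he]; exact subset_union_right
  have st : V \ P.A u v ⊆ (P.tr u v w)ᶜ := fun z hz =>
    nmem_tr.2 ⟨hz.2, (hVN hz.1).2.1, (hVN hz.1).2.2⟩
  have k1 : ∀ z ∈ C1, P.W u v w z = P.W u v w z1 := fun z hz =>
    TT.wt_const c1 (s1.trans st) hz z1C
  have k2 : ∀ z ∈ C2, P.W u v w z = P.W u v w z2 := fun z hz =>
    TT.wt_const c2 (s2.trans st) hz z2C
  have hO : r ∈ closure (IsTri.Out (P.f u v) (P.f v w) (P.f w u)) :=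
    TT.tri_Out (Or.inl (Or.inl hr))
  have hI : r ∈ closure (IsTri.Ins (P.f u v) (P.f v w) (P.f w u)) :=
    TT.tri_Ins (Or.inl (Or.inl hr))
  rw [mem_closure_iff_nhds] at hO hI
  have a1 : ∀ z ∈ V, z ∉ P.tr u v w → P.W u v w z = P.W u v w z1 ∨ P.W u v w z = P.W u v w z2 := by
    intro z hz hz2
    have : z ∈ C1 ∪ C2 := by rw [← he]; exact ⟨hz, (nmem_tr.1 hz2).1⟩
    rcases this with h | h
    · exact Or.inl (k1 z h)
    · exact Or.inr (k2 z h)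
  constructor
  · obtain ⟨z, hz, hz1, hz2⟩ := hO V hV
    change P.W u v w z = 0 at hz2
    rcases a1 z hz hz1 with h | h
    · exact ⟨z1, ⟨g1, (hVN (s1 z1C).1).1⟩, st (s1 z1C), by rw [← h, hz2]⟩
    · exact ⟨z2, ⟨g2, (hVN (s2 z2C).1).1⟩, st (s2 z2C), by rw [← h, hz2]⟩
  · obtain ⟨z, hz, hz1, hz2⟩ := hI V hV
    change P.W u v w z ≠ 0 at hz2
    rcases a1 z hz hz1 with h | h
    · exact ⟨z1, ⟨g1, (hVN (s1 z1C).1).1⟩, st (s1 z1C), by rwa [← h]⟩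
    · exact ⟨z2, ⟨g2, (hVN (s2 z2C).1).1⟩, st (s2 z2C), by rwa [← h]⟩

lemma cross_nv (huv : u ≠ v) (ux : u ≠ x) (hxy : x ≠ y) (uy : u ≠ y)
    (h1 : r ∈ P.A u v) (h2 : r ∈ P.A x y) : r ≠ P.vtx u := by
  rintro rfl
  exact P.vnot x y u hxy ux uy h2

/-- step (i): an end of a crossing edge is not inside the opposite triangle. -/
lemma cross_out (huv : u ≠ v) (hxy : x ≠ y) (ux : u ≠ x) (uy : u ≠ y) (vx : v ≠ x) (vy : v ≠ y)
    (h1 : r ∈ P.A u v) (h2 : r ∈ P.A x y) : P.W u v x (P.vtx y) = 0 := by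
  by_contra hw
  have nu : r ≠ P.vtx u := cross_nv huv ux hxy uy h1 h2
  have nv : r ≠ P.vtx v := cross_nv huv.symm vx hxy vy (by rwa [A_symm huv.symm]) h2
  have e1 : r ∉ P.A v x := fun h => nv (adj' huv.symm vx ux (by rwa [A_symm huv.symm]) h)
  have e2 : r ∉ P.A x u := fun h => nu (adj' huv ux vx h1 (by rwa [A_symm ux]))
  obtain ⟨⟨p, ⟨hp, -⟩, hp2, hp3⟩, -⟩ := both huv vx ux.symm e1 e2
    (P.cr u v x y huv hxy ux uy vx vy r ⟨h1, h2⟩).2 Filter.univ_mem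
  refine conv_c huv vx ux.symm uy.symm vy.symm hxy.symm hw (x := y) ?_ hp2 hp3
  rw [A_symm hxy.symm]; exact hp

lemma diff_const (hxu : x ≠ u) (hvx : v ≠ x) (hvy : v ≠ y) (hyu : y ≠ u) (huv : u ≠ v)
    (e1 : r ∉ P.A v x) (e2 : r ∉ P.A x u) (e3 : r ∉ P.A v y) (e4 : r ∉ P.A y u) :
    ∃ N ∈ 𝓝 r, (∀ p ∈ N, p ∉ P.A v x ∧ p ∉ P.A x u ∧ p ∉ P.A v y ∧ p ∉ P.A y u) ∧
      ∀ p ∈ N, ∀ q ∈ N, p ∉ P.A u v → q ∉ P.A u v →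
      P.W u v x p - P.W u v y p = P.W u v x q - P.W u v y q := by
  set G : ℂ → ℝ := fun p => θ (P.f v x) p + θ (P.f x u) p - θ (P.f v y) p - θ (P.f y u) p with hG
  have cG : ContinuousAt G r :=
    (((θ_continuousAt (P.cont _ _ hvx) e1).add (θ_continuousAt (P.cont _ _ hxu) e2)).sub
      (θ_continuousAt (P.cont _ _ hvy) e3)).sub (θ_continuousAt (P.cont _ _ hyu) e4)
  have hD : ∀ p, P.W u v x p - P.W u v y p = G p := by
    intro p; simp only [W, wt, hG]; ring
  have m1 := (A_closed hvx).isOpen_compl.mem_nhds e1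
  have m2 := (A_closed hxu).isOpen_compl.mem_nhds e2
  have m3 := (A_closed hvy).isOpen_compl.mem_nhds e3
  have m4 := (A_closed hyu).isOpen_compl.mem_nhds e4
  have m5 := cG.preimage_mem_nhds (Metric.ball_mem_nhds (G r) (by norm_num : (0 : ℝ) < 1/2))
  refine ⟨_, Filter.inter_mem m5 (Filter.inter_mem (Filter.inter_mem m1 m2)
    (Filter.inter_mem m3 m4)), fun p hp => ⟨hp.2.1.1, hp.2.1.2, hp.2.2.1, hp.2.2.2⟩, ?_⟩
  intro p hp q hq hpu hqu
  obtain ⟨i1, -, hi1⟩ := (T (P := P) huv hvx hxu).ell_int (p := p)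
    (nmem_tr.2 ⟨hpu, hp.2.1.1, hp.2.1.2⟩)
  obtain ⟨i2, -, hi2⟩ := (T (P := P) huv hvy hyu).ell_int (p := p)
    (nmem_tr.2 ⟨hpu, hp.2.2.1, hp.2.2.2⟩)
  obtain ⟨i3, -, hi3⟩ := (T (P := P) huv hvx hxu).ell_int (p := q)
    (nmem_tr.2 ⟨hqu, hq.2.1.1, hq.2.1.2⟩)
  obtain ⟨i4, -, hi4⟩ := (T (P := P) huv hvy hyu).ell_int (p := q)
    (nmem_tr.2 ⟨hqu, hq.2.2.1, hq.2.2.2⟩)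
  change P.W u v x p = i1 at hi1
  change P.W u v y p = i2 at hi2
  change P.W u v x q = i3 at hi3
  change P.W u v y q = i4 at hi4
  have b1 := hp.1
  have b2 := hq.1
  simp only [mem_preimage, Metric.mem_ball, Real.dist_eq, abs_lt] at b1 b2
  rw [← hD p] at b1
  rw [← hD q] at b2
  rw [hi1, hi2] at b1
  rw [hi3, hi4] at b2
  rw [hi1, hi2, hi3, hi4]
  have l1 : (i1 - i2 : ℤ) - (i3 - i4) < 1 := by
    have : ((i1 - i2 - (i3 - i4) : ℤ) : ℝ) < 1 := by push_cast; linarith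
    exact_mod_cast this
  have l2 : (i3 - i4 : ℤ) - (i1 - i2) < 1 := by
    have : ((i3 - i4 - (i1 - i2) : ℤ) : ℝ) < 1 := by push_cast; linarith
    exact_mod_cast this
  have : i1 - i2 = i3 - i4 := by omega
  exact_mod_cast this

/-- along `xy` before the crossing with `uv`, winding around `uvy` vanishes -/
lemma half (huv : u ≠ v) (hxy : x ≠ y) (ux : u ≠ x) (uy : u ≠ y) (vx : v ≠ x) (vy : v ≠ y)
    {s : ℝ} (hs : s ∈ Icc (0 : ℝ) 1) (h1 : P.f x y s ∈ P.A u v) {t : ℝ} (t0 : 0 ≤ t) (ts : t < s) :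
    P.W u v y (P.f x y t) = 0 := by
  have h2 : P.f x y s ∈ P.A x y := mem_im hs
  have hz := cross_out (P := P) huv hxy.symm uy ux vy vx h1 (by rwa [A_symm hxy.symm])
  rw [← hz, ← P.f0 x y hxy]
  have hss : Ico 0 s ⊆ Icc (0 : ℝ) 1 := fun t ht => ⟨ht.1, by linarith [ht.2, hs.2]⟩
  refine (T (P := P) huv vy uy.symm).wt_const (S := P.f x y '' Ico 0 s)
    (isPreconnected_Ico.image _ ((P.cont x y hxy).mono hss)) ?_
    ⟨t, ⟨t0, ts⟩, rfl⟩ ⟨0, ⟨le_rfl, lt_of_le_of_lt t0 ts⟩, rfl⟩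
  rintro _ ⟨t', ht', rfl⟩
  have m : P.f x y t' ∈ P.A x y := mem_im (hss ht')
  have ny : P.f x y t' ≠ P.vtx y := by
    rw [← P.f1 x y hxy]
    intro h
    have := P.inj x y hxy (hss ht') o01 h
    linarith [ht'.2, hs.2]
  have m' : P.f x y t' ∈ P.A y x := by rwa [A_symm hxy.symm]
  refine nmem_tr.2 ⟨fun h => ?_, fun h => ?_, fun h => ?_⟩
  · have := (P.cr u v x y huv hxy ux uy vx vy _ ⟨h1, h2⟩).1 ⟨h, m⟩
    have := P.inj x y hxy (hss ht') hs this
    linarith [ht'.2]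
  · rw [A_symm vy] at h
    exact ny (adj' hxy.symm vy.symm vx.symm m' h)
  · exact ny (adj' hxy.symm uy.symm ux.symm m' h)

lemma half' (huv : u ≠ v) (hxy : x ≠ y) (ux : u ≠ x) (uy : u ≠ y) (vx : v ≠ x) (vy : v ≠ y)
    {s : ℝ} (hs : s ∈ Icc (0 : ℝ) 1) (h1 : P.f x y s ∈ P.A u v) {t : ℝ} (t0 : t ≤ 1) (ts : s < t) :
    P.W u v x (P.f x y t) = 0 := by
  have e : ∀ t, P.f x y t = P.f y x (1 - t) := by
    intro t; rw [P.rev x y hxy]; simp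
  rw [e]
  exact half huv hxy.symm uy ux vy vx (s := 1 - s) ⟨by linarith [hs.2], by linarith [hs.1]⟩
    (by rwa [← e]) (by linarith) (by linarith)

lemma crossing (huv : u ≠ v) (hxy : x ≠ y) (ux : u ≠ x) (uy : u ≠ y) (vx : v ≠ x) (vy : v ≠ y)
    (h1 : r ∈ P.A u v) (h2 : r ∈ P.A x y) : P.k u v x = - P.k u v y ∧
    ∃ N ∈ 𝓝 r, ∀ p ∈ N, p ∉ P.A u v → P.W u v x p ≠ 0 ∨ P.W u v y p ≠ 0 := by
  have nu : r ≠ P.vtx u := cross_nv huv ux hxy uy h1 h2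
  have h1' : r ∈ P.A v u := by rwa [A_symm huv.symm]
  have nv : r ≠ P.vtx v := cross_nv huv.symm vx hxy vy h1' h2
  have nx : r ≠ P.vtx x := cross_nv hxy ux.symm huv vx.symm h2 h1
  have ny : r ≠ P.vtx y := cross_nv hxy.symm uy.symm huv vy.symm (by rwa [A_symm hxy.symm]) h1
  have e1 : r ∉ P.A v x := fun h => nv (adj' huv.symm vx ux h1' h)
  have e2 : r ∉ P.A x u := fun h => nu (adj' huv ux vx h1 (by rwa [A_symm ux]))
  have e3 : r ∉ P.A v y := fun h => nv (adj' huv.symm vy uy h1' h)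
  have e4 : r ∉ P.A y u := fun h => nu (adj' huv uy vy h1 (by rwa [A_symm uy]))
  obtain ⟨N, hN, hN1, hN2⟩ := diff_const ux.symm vx vy uy.symm huv e1 e2 e3 e4
  have hcr := P.cr u v x y huv hxy ux uy vx vy r ⟨h1, h2⟩
  obtain ⟨s, hs, rfl⟩ := h2
  have cut : ∀ t ∈ Icc (0 : ℝ) 1, t ≠ s → P.f x y t ∉ P.A u v := by
    intro t ht hts h
    exact hts (P.inj x y hxy ht hs (hcr.1 ⟨h, mem_im ht⟩))
  obtain ⟨-, p1, ⟨⟨t, ht, rfl⟩, pN⟩, hp1, hw1⟩ := both huv vx ux.symm e1 e2 hcr.2 hN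
  obtain ⟨-, p2, ⟨⟨t', ht', rfl⟩, pN'⟩, hp2, hw2⟩ := both huv vy uy.symm e3 e4 hcr.2 hN
  have o1 : t < s := by
    by_contra hh
    rcases (not_lt.1 hh).eq_or_lt with h | h
    · subst h; exact (nmem_tr.1 hp1).1 h1
    · exact hw1 (half' huv hxy ux uy vx vy hs h1 ht.2 h)
  have o2 : s < t' := by
    by_contra hh
    rcases (not_lt.1 hh).eq_or_lt with h | h
    · subst h; exact (nmem_tr.1 hp2).1 h1
    · exact hw2 (half huv hxy ux uy vx vy hs h1 ht'.1 h)
  have z1 := half huv hxy ux uy vx vy hs h1 ht.1 o1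
  have z2 := half' huv hxy ux uy vx vy hs h1 ht'.2 o2
  have E := hN2 _ pN _ pN' (nmem_tr.1 hp1).1 (nmem_tr.1 hp2).1
  rw [z1, z2, sub_zero, zero_sub] at E
  constructor
  · rw [← k_eq huv vx ux.symm hp1 hw1, ← k_eq huv vy uy.symm hp2 hw2, E]
  · refine ⟨N, hN, fun p hp hpu => ?_⟩
    have E2 := hN2 _ pN _ hp (nmem_tr.1 hp1).1 hpu
    rw [z1, sub_zero] at E2
    by_contra hh
    push Not at hh
    rw [hh.1, hh.2, sub_zero] at E2
    exact hw1 E2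

/-- the outer region -/
def Fo (P : PD n) : Set ℂ := {p | p ∉ P.AA ∧ ∀ a b c, a ≠ b → b ≠ c → c ≠ a → P.W a b c p = 0}

lemma Fo_near (hq : q ∉ P.AA) : ∀ᶠ p in 𝓝 q, (p ∈ P.Fo ↔ q ∈ P.Fo) := by
  have h1 : ∀ᶠ p in 𝓝 q, p ∉ P.AA := AA_closed.isOpen_compl.mem_nhds hq
  have h2 : ∀ᶠ p in 𝓝 q, ∀ a b c, a ≠ b → b ≠ c → c ≠ a → P.W a b c p = P.W a b c q := by
    simp only [Filter.eventually_all]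
    intro a b c hab hbc hca
    exact (W_near hab hbc hca (off_tr hq hab hbc hca)).mono fun p hp => hp.2
  filter_upwards [h1, h2] with p hp1 hp2
  constructor
  · rintro ⟨_, h⟩
    exact ⟨hq, fun a b c hab hbc hca => by rw [← hp2 a b c hab hbc hca]; exact h a b c hab hbc hca⟩
  · rintro ⟨_, h⟩
    exact ⟨hp1, fun a b c hab hbc hca => by rw [hp2 a b c hab hbc hca]; exact h a b c hab hbc hca⟩

lemma Fo_frontier : frontier P.Fo ⊆ P.AA := by
  intro z hz
  by_contra h
  have := Fo_near h
  rw [frontier_eq_closure_inter_closure] at hz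
  rw [mem_inter_iff, mem_closure_iff_frequently, mem_closure_iff_frequently] at hz
  obtain ⟨p, hp, hp'⟩ := (hz.1.and_eventually this).exists
  obtain ⟨q, hq, hq'⟩ := (hz.2.and_eventually this).exists
  exact hq (hq'.2 (hp'.1 hp))

lemma exists_third (hn : 3 ≤ n) (u v : Fin n) : ∃ w : Fin n, w ≠ u ∧ w ≠ v := by
  by_contra hc
  push Not at hc
  have : (Finset.univ : Finset (Fin n)) ⊆ {u, v} := by
    intro w _
    by_cases hw : w = u
    · simp [hw]
    · simp [hc w hw]
  have := Finset.card_le_card this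
  have h2 := Finset.card_le_two (a := u) (b := v)
  simp at this
  omega

lemma AA_far (hn : 3 ≤ n) : Bornology.IsBounded (P.Fo)ᶜ := by
  obtain ⟨R, hR⟩ := W_far (P := P)
  refine (Metric.isBounded_closedBall (x := (0 : ℂ)) (r := R)).subset ?_
  intro p hp
  rw [mem_closedBall_zero_iff]
  by_contra hh
  apply hp
  have := hR p (not_le.1 hh)
  refine ⟨fun h => ?_, fun a b c h1 h2 h3 => (this a b c h1 h2 h3).2⟩
  obtain ⟨u, v, huv, h⟩ := mem_AA.1 h
  obtain ⟨w, hu, hv⟩ := exists_third hn u v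
  exact (nmem_tr.1 (this u v w huv hv.symm hu).1).1 h

lemma no_cross (huv : u ≠ v) (hxy : x ≠ y) (ux : u ≠ x) (uy : u ≠ y) (vx : v ≠ x) (vy : v ≠ y)
    (h1 : r ∈ P.A u v) (h2 : r ∈ P.A x y) : r ∉ closure P.Fo := by
  obtain ⟨-, N, hN, h⟩ := crossing huv hxy ux uy vx vy h1 h2
  rw [mem_closure_iff_nhds]
  intro hc
  obtain ⟨p, hp, hF⟩ := hc N hN
  rcases h p hp (off hF.1 huv) with h | h
  · exact h (hF.2 u v x huv vx ux.symm)
  · exact h (hF.2 u v y huv vy uy.symm)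

lemma hull_log {K : Set ℂ} (hK : IsClosed K) (hKF : K ⊆ closure P.Fo)
    (hv : ∀ v, P.vtx v ∉ closure P.Fo) (hp : p ∉ P.AA)
    (s : Finset (Fin n × Fin n)) (hs : ∀ e ∈ s, e.1 < e.2) :
    HasLog (fun z => z - p) (⋃ e ∈ s, (P.A e.1 e.2 ∩ K)) ∧
      IsClosed (⋃ e ∈ s, (P.A e.1 e.2 ∩ K)) := by
  classical
  induction s using Finset.induction_on with
  | empty => exact ⟨⟨fun _ => 0, by simp, by simp⟩, by simp⟩
  | insert e s he ih =>
    have ih := ih fun e' h' => hs e' (Finset.mem_insert_of_mem h')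
    have hee : e.1 ≠ e.2 := (hs e (Finset.mem_insert_self _ _)).ne
    rw [Finset.set_biUnion_insert]
    have hc : IsClosed (P.A e.1 e.2 ∩ K) := (A_closed hee).inter hK
    refine ⟨HasLog.union (z₀ := 0) hc ih.2 ?_ ih.1 ?_, hc.union ih.2⟩
    · exact (hasLog_arc (by norm_num) (P.cont _ _ hee) (P.inj _ _ hee) (off hp hee)).mono
        inter_subset_left
    · rintro z ⟨⟨hz1, hzK⟩, hz2⟩
      exfalso
      simp only [mem_iUnion] at hz2
      obtain ⟨e', he', hz2, -⟩ := hz2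
      have hzF := hKF hzK
      have hlt := hs e (Finset.mem_insert_self _ _)
      have hlt' := hs e' (Finset.mem_insert_of_mem he')
      have hne : e ≠ e' := by rintro rfl; exact he he'
      obtain ⟨a, b⟩ := e
      obtain ⟨c, d⟩ := e'
      simp only at *
      have hcd := hlt'.ne
      by_cases hac : a = c
      · subst hac
        have hbd : b ≠ d := by rintro rfl; exact hne rfl
        exact hv a (adj' hee hcd hbd hz1 hz2 ▸ hzF)
      by_cases hbd : b = d
      · subst hbd
        rw [A_symm hee] at hz1
        rw [A_symm hcd] at hz2
        exact hv b (adj' hee.symm hcd.symm hac hz1 hz2 ▸ hzF)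
      by_cases had : a = d
      · subst had
        rw [A_symm hcd] at hz2
        have hbc : b ≠ c := by rintro rfl; exact absurd hlt (not_lt.2 hlt'.le)
        exact hv a (adj' hee hcd.symm hbc hz1 hz2 ▸ hzF)
      by_cases hbc : b = c
      · subst hbc
        rw [A_symm hee] at hz1
        exact hv b (adj' hee.symm hcd had hz1 hz2 ▸ hzF)
      exact no_cross hee hcd hac had hbc hbd hz1 hz2 hzF

lemma extreme (hn : 3 ≤ n) : ∃ v, P.vtx v ∈ closure P.Fo := by
  by_contra hv
  push Not at hv
  set U := (closure P.Fo)ᶜ with hU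
  have Uo : IsOpen U := isClosed_closure.isOpen_compl
  have Ub : Bornology.IsBounded U := (AA_far hn).subset (compl_subset_compl.2 subset_closure)
  have Une : U.Nonempty := ⟨P.vtx ⟨0, by omega⟩, hv _⟩
  obtain ⟨p, hpA, hpU⟩ := (dense_AA (P := P) hn).exists_mem_open Uo Une
  have hfr : frontier U ⊆ frontier P.Fo := by
    rw [hU, frontier_compl]; exact frontier_closure_subset
  classical
  obtain ⟨⟨g, hg, he⟩, -⟩ := hull_log (P := P) (K := frontier U) isClosed_frontier
    (hfr.trans frontier_subset_closure) hv hpA (Finset.univ.filter fun e => e.1 < e.2)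
    (by simp)
  have hsub : frontier U ⊆ ⋃ e ∈ (Finset.univ.filter fun e : Fin n × Fin n => e.1 < e.2),
      (P.A e.1 e.2 ∩ frontier U) := by
    intro z hz
    obtain ⟨u, v, huv, h⟩ := mem_AA.1 (Fo_frontier (hfr hz))
    simp only [mem_iUnion]
    rcases lt_or_gt_of_ne huv with h' | h'
    · exact ⟨(u, v), by simpa using h', h, hz⟩
    · exact ⟨(v, u), by simpa using h', by rwa [A_symm huv.symm], hz⟩
  have := eilenberg Uo Ub hpU (φ := fun _ => 1) (g := g) (k := 1) continuousOn_const
    (by simp) (hg.mono hsub) (fun z hz => by rw [he z (hsub hz)]; simp)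
  norm_num at this

lemma ext_W (hv : P.vtx v ∈ closure P.Fo) (hab : a ≠ b) (hbc : b ≠ c) (hca : c ≠ a)
    (va : v ≠ a) (vb : v ≠ b) (vc : v ≠ c) :
    P.vtx v ∉ P.tr a b c ∧ P.W a b c (P.vtx v) = 0 := by
  have h : P.vtx v ∉ P.tr a b c :=
    nmem_tr.2 ⟨P.vnot a b v hab va vb, P.vnot b c v hbc vb vc, P.vnot c a v hca vc va⟩
  refine ⟨h, ?_⟩
  rw [mem_closure_iff_frequently] at hv
  obtain ⟨p, hp, -, e⟩ := (hv.and_eventually (W_near hab hbc hca h)).exists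
  rw [← e]
  exact hp.2 a b c hab hbc hca

lemma trans_aux (hn : 3 ≤ n) (hv : P.vtx v ∈ closure P.Fo) (hab : a ≠ b) (hbc : b ≠ c)
    (hca : c ≠ a) (va : v ≠ a) (vb : v ≠ b) (vc : v ≠ c)
    (h1 : 0 < P.k v a b) (h2 : 0 < P.k v b c) (h3 : 0 < P.k v c a) : False := by
  obtain ⟨ht, h0⟩ := ext_W hv hab hbc hca va vb vc
  have hN := W_near hab hbc hca ht
  obtain ⟨N, hN1, hNo, hN2⟩ := eventually_nhds_iff.1 hN
  have TT := T (P := P) va hab vb.symm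
  have hI := TT.tri_Ins (Or.inl (Or.inl (vl va)))
  obtain ⟨q, hq1, hq2⟩ := mem_closure_iff.1 hI N hNo hN2
  obtain ⟨p, hp1, hp2, hp3⟩ := (dense_AA (P := P) hn).exists_mem_open
    (hNo.inter TT.Ins_open) ⟨q, hq1, hq2⟩
  have e := (hN1 p hp2).2
  rw [h0, cocycle va vb vc (off hp1 va) (off hp1 vb) (off hp1 vc),
    k_eq va hab vb.symm hp3.1 hp3.2] at e
  have c2 := W_cases vb hbc vc.symm (off_tr hp1 vb hbc vc.symm)
  have c3 := W_cases vc hca va.symm (off_tr hp1 vc hca va.symm)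
  rcases c2 with c2 | c2 <;> rcases c3 with c3 | c3 <;> rw [c2, c3] at e <;> linarith

/-- the order -/
def R (P : PD n) (v a b : Fin n) : Prop :=
  b ≠ v ∧ (a = v ∨ (a ≠ v ∧ a ≠ b ∧ 0 < P.k v a b))

lemma R_irrefl : ¬ P.R v a a := by
  rintro ⟨h, rfl | ⟨-, h', -⟩⟩
  · exact h rfl
  · exact h' rfl

lemma k_swap' (va : v ≠ a) (vb : v ≠ b) (hab : a ≠ b) : P.k v b a = - P.k v a b := by
  rw [← k_rot vb hab.symm va.symm, k_swap hab vb.symm va, ← k_rot va hab vb.symm]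

lemma R_total (hab : a ≠ b) : P.R v a b ∨ P.R v b a := by
  by_cases ha : a = v
  · left; exact ⟨fun h => hab (ha.trans h.symm), Or.inl ha⟩
  by_cases hb : b = v
  · right; exact ⟨ha, Or.inl hb⟩
  rcases lt_or_gt_of_ne (k_ne (P := P) (Ne.symm ha) hab hb) with h | h
  · right
    refine ⟨ha, Or.inr ⟨hb, hab.symm, ?_⟩⟩
    rw [k_swap' (Ne.symm ha) (Ne.symm hb) hab]; linarith
  · left
    exact ⟨hb, Or.inr ⟨ha, hab, h⟩⟩

lemma R_trans (hn : 3 ≤ n) (hv : P.vtx v ∈ closure P.Fo) (h1 : P.R v a b) (h2 : P.R v b c) :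
    P.R v a c := by
  obtain ⟨hb, h1⟩ := h1
  obtain ⟨hc, h2⟩ := h2
  refine ⟨hc, ?_⟩
  rcases h1 with h1 | ⟨ha, hab, h1⟩
  · exact Or.inl h1
  rcases h2 with h2 | ⟨-, hbc, h2⟩
  · exact absurd h2 hb
  refine Or.inr ⟨ha, ?_⟩
  have hac : a ≠ c := by
    rintro rfl
    rw [k_swap' (Ne.symm ha) (Ne.symm hb) hab] at h2
    linarith
  refine ⟨hac, ?_⟩
  by_contra h3
  refine trans_aux hn hv hab hbc hac.symm (Ne.symm ha) (Ne.symm hb) (Ne.symm hc) h1 h2 ?_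
  rw [k_swap' (Ne.symm ha) (Ne.symm hc) hac]
  have := k_ne (P := P) (Ne.symm ha) hac hc
  rcases lt_or_gt_of_ne this with h | h
  · linarith
  · exact absurd h h3

/-- `x` is between -/
def Btw (P : PD n) (v a b c x : Fin n) : Prop :=
  (∃ y, (y = a ∨ y = b ∨ y = c) ∧ P.R v y x) ∧ (∃ y, (y = a ∨ y = b ∨ y = c) ∧ P.R v x y)

lemma Btw_rot (h : P.Btw v b c a x) : P.Btw v a b c x := by
  obtain ⟨⟨y, hy, h1⟩, ⟨z, hz, h2⟩⟩ := h
  exact ⟨⟨y, by tauto, h1⟩, ⟨z, by tauto, h2⟩⟩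

lemma IV_v (hab : v ≠ b) (hbc : b ≠ c) (hca : c ≠ v) (xa : x ≠ v) (xb : x ≠ b) (xc : x ≠ c)
    (hw : P.W v b c (P.vtx x) ≠ 0) : P.Btw v v b c x := by
  refine ⟨⟨v, Or.inl rfl, xa, Or.inl rfl⟩, ?_⟩
  have s1 := S hab hbc hca xa xb xc hw
  have s2 := S (P := P) hca hab hbc xc xa xb (by rwa [← W_rot])
  rw [← k_rot hca xa.symm xc, ← k_rot hca hab hbc] at s2
  have hk := k_ne (P := P) hab hbc hca
  rcases lt_or_gt_of_ne hk with h | h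
  · refine ⟨b, by tauto, hab.symm, Or.inr ⟨xa, xb, ?_⟩⟩
    rw [k_swap' hab xa.symm xb.symm]; linarith
  · refine ⟨c, by tauto, hca, Or.inr ⟨xa, xc, ?_⟩⟩
    linarith

lemma IV_cross (hab : a ≠ b) (va : v ≠ a) (vb : v ≠ b) (xv : x ≠ v) (xa : x ≠ a) (xb : x ≠ b)
    (h1 : r ∈ P.A v x) (h2 : r ∈ P.A a b) : P.Btw v a b c x := by
  have hk := (crossing xv.symm hab va vb xa xb h1 h2).1
  have ha := k_ne (P := P) xv.symm xa va.symm
  have e1 := k_swap' (P := P) xv.symm va xa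
  have e2 := k_swap' (P := P) xv.symm vb xb
  rcases lt_or_gt_of_ne ha with h | h
  · exact ⟨⟨a, by tauto, xv, Or.inr ⟨va.symm, xa.symm, by linarith⟩⟩,
      ⟨b, by tauto, vb.symm, Or.inr ⟨xv, xb, by linarith⟩⟩⟩
  · exact ⟨⟨b, by tauto, xv, Or.inr ⟨vb.symm, xb.symm, by linarith⟩⟩,
      ⟨a, by tauto, va.symm, Or.inr ⟨xv, xa, by linarith⟩⟩⟩

lemma IV (hv : P.vtx v ∈ closure P.Fo) (hab : a ≠ b) (hbc : b ≠ c) (hca : c ≠ a)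
    (xa : x ≠ a) (xb : x ≠ b) (xc : x ≠ c) (hw : P.W a b c (P.vtx x) ≠ 0) : P.Btw v a b c x := by
  by_cases ha : v = a
  · subst ha; exact IV_v hab hbc hca xa xb xc hw
  by_cases hb : v = b
  · subst hb
    exact Btw_rot (IV_v hbc hca hab xb xc xa (by rwa [W_rot]))
  by_cases hc : v = c
  · subst hc
    exact Btw_rot (Btw_rot (IV_v hca hab hbc xc xa xb (by rwa [← W_rot])))
  obtain ⟨-, h0⟩ := ext_W hv hab hbc hca ha hb hc
  have xv : x ≠ v := by rintro rfl; exact hw h0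
  have : ∃ r ∈ P.A v x, r ∈ P.tr a b c := by
    by_contra hh
    push Not at hh
    apply hw
    rw [← h0]
    exact (T hab hbc hca).wt_const (isPreconnected_Icc.image _ (P.cont v x xv.symm))
      (fun r hr => hh r hr) (vr xv.symm) (vl xv.symm)
  obtain ⟨r, hr, h⟩ := this
  rcases h with (h | h) | h
  · exact IV_cross hab ha hb xv xa xb hr h
  · exact Btw_rot (IV_cross hbc hb hc xv xb xc hr h)
  · exact Btw_rot (Btw_rot (IV_cross hca hc ha xv xc xa hr h))

end PD

lemma rank_perm {n : ℕ} (R : Fin n → Fin n → Prop) (ir : ∀ a, ¬ R a a)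
    (tr : ∀ a b c, R a b → R b c → R a c) (tot : ∀ a b, a ≠ b → R a b ∨ R b a) :
    ∃ π : Equiv.Perm (Fin n), ∀ a b, R a b → π a < π b := by
  classical
  let S : Fin n → Finset (Fin n) := fun a => Finset.univ.filter fun b => R b a
  have hS : ∀ a, (S a).card < n := by
    intro a
    have : S a ⊂ Finset.univ := by
      rw [Finset.ssubset_univ_iff]
      intro h
      have : a ∈ S a := by rw [h]; simp
      exact ir a (by simpa [S] using this)
    simpa using Finset.card_lt_card this
  have mono : ∀ a b, R a b → (S a).card < (S b).card := by
    intro a b h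
    apply Finset.card_lt_card
    rw [Finset.ssubset_iff_of_subset]
    · exact ⟨a, by simpa [S] using h, by simpa [S] using ir a⟩
    · intro c hc
      simp only [S, Finset.mem_filter, Finset.mem_univ, true_and] at hc ⊢
      exact tr c a b hc h
  let g : Fin n → Fin n := fun a => ⟨(S a).card, hS a⟩
  have ginj : Function.Injective g := by
    intro a b h
    by_contra hab
    have h' : (S a).card = (S b).card := congrArg Fin.val h
    rcases tot a b hab with h1 | h1
    · exact absurd (mono _ _ h1) (by omega)
    · exact absurd (mono _ _ h1) (by omega)
  exact ⟨Equiv.ofBijective g (Finite.injective_iff_bijective.1 ginj), fun a b h => mono a b h⟩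

theorem PD.main {n : ℕ} (hn : 3 ≤ n) (P : PD n) : ∃ π : Equiv.Perm (Fin n), ∀ a b c x : Fin n,
    a ≠ b → b ≠ c → c ≠ a → x ≠ a → x ≠ b → x ≠ c →
    wt (P.f a b) (P.f b c) (P.f c a) (P.vtx x) ≠ 0 →
    (∃ y, (y = a ∨ y = b ∨ y = c) ∧ π y < π x) ∧ (∃ y, (y = a ∨ y = b ∨ y = c) ∧ π x < π y) := by
  obtain ⟨v, hv⟩ := PD.extreme (P := P) hn
  obtain ⟨π, hπ⟩ := rank_perm (P.R v) (fun a => PD.R_irrefl)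
    (fun a b c => PD.R_trans hn hv) (fun a b => PD.R_total)
  refine ⟨π, fun a b c x h1 h2 h3 h4 h5 h6 hw => ?_⟩
  obtain ⟨⟨y, hy, hy'⟩, ⟨z, hz, hz'⟩⟩ := PD.IV hv h1 h2 h3 h4 h5 h6 hw
  exact ⟨⟨y, hy, hπ _ _ hy'⟩, ⟨z, hz, hπ _ _ hz'⟩⟩

end IVO

namespace IVO

lemma exists_chart (q : SpherePt) : ∃ ψ : ℂ → SpherePt, IsOpenEmbedding ψ ∧ range ψ = {q}ᶜ := by
  haveI : Fact (Module.finrank ℝ (EuclideanSpace ℝ (Fin 3)) = 2 + 1) := ⟨by simp⟩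
  let e := stereographic' 2 q
  let L : ℂ ≃ₜ EuclideanSpace ℝ (Fin 2) :=
    Complex.orthonormalBasisOneI.repr.toHomeomorph
  have he : IsOpenEmbedding e.symm := by
    refine e.symm.to_isOpenEmbedding ?_
    simp [e]
  refine ⟨e.symm ∘ L, he.comp L.isOpenEmbedding, ?_⟩
  rw [range_comp, L.surjective.range_eq, image_univ]
  have := e.symm.image_source_eq_target
  have h2 : e.symm.source = univ := by simp [e]
  rw [h2, image_univ] at this
  rw [this]
  simp [e]

section chart

variable {X : Type*} [TopologicalSpace X] {ψ : ℂ → X} {q : X}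

lemma crosses_pull (hψ : IsOpenEmbedding ψ) {σ γ : Set ℂ} {r : ℂ}
    (h : CrossesAt (ψ '' σ) (ψ '' γ) (ψ r)) : CrossesAt σ γ r := by
  obtain ⟨h1, h2, h3⟩ := h
  refine ⟨(hψ.injective.mem_set_image).1 h1, (hψ.injective.mem_set_image).1 h2, ?_⟩
  intro U hU
  obtain ⟨V, hV, hVU, C1, C2, he, hd, c1, c2, ⟨z1, g1, k1⟩, ⟨z2, g2, k2⟩⟩ :=
    h3 _ (hψ.isOpenMap.image_mem_nhds hU)
  have s1 : C1 ⊆ range ψ := fun z hz => by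
    have : z ∈ V \ ψ '' σ := by rw [he]; exact Or.inl hz
    exact image_subset_range _ _ (hVU this.1)
  have s2 : C2 ⊆ range ψ := fun z hz => by
    have : z ∈ V \ ψ '' σ := by rw [he]; exact Or.inr hz
    exact image_subset_range _ _ (hVU this.1)
  refine ⟨ψ ⁻¹' V, hψ.continuous.continuousAt.preimage_mem_nhds hV, ?_,
    ψ ⁻¹' C1, ψ ⁻¹' C2, ?_, hd.preimage _, ?_, ?_, ?_, ?_⟩
  · intro z hz
    exact (hψ.injective.mem_set_image).1 (hVU hz)
  · rw [← preimage_union, ← he, preimage_diff, hψ.injective.preimage_image]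
  · rw [← hψ.isInducing.isPreconnected_image, image_preimage_eq_of_subset s1]; exact c1
  · rw [← hψ.isInducing.isPreconnected_image, image_preimage_eq_of_subset s2]; exact c2
  · obtain ⟨w, hw, rfl⟩ := g1
    exact ⟨w, hw, k1⟩
  · obtain ⟨w, hw, rfl⟩ := g2
    exact ⟨w, hw, k2⟩

variable {f g h : ℝ → ℂ}

lemma sepA [T2Space X] (hψ : IsOpenEmbedding ψ) (T : IsTri f g h) {S : Set X}
    (hS : IsPreconnected S) (hd : S ⊆ (ψ '' tri f g h)ᶜ) {p : ℂ} (hp : ψ p ∈ S)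
    (hw : wt f g h p ≠ 0) {z : X} (hz : z ∈ S) :
    ∃ p', z = ψ p' ∧ p' ∉ tri f g h ∧ wt f g h p' ≠ 0 := by
  have hcl : IsCompact (IsTri.Ins f g h ∪ tri f g h) := by
    refine Metric.isCompact_of_isClosed_isBounded ?_ (T.Ins_bdd.union T.compact.isBounded)
    have : IsTri.Ins f g h ∪ tri f g h = (IsTri.Out f g h)ᶜ := by
      ext z
      simp only [IsTri.Ins, IsTri.Out, mem_union, mem_setOf_eq, mem_compl_iff]
      by_cases h1 : z ∈ tri f g h <;> by_cases h2 : wt f g h z = 0 <;> simp [h1, h2]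
    rw [this]
    exact T.Out_open.isClosed_compl
  have o1 : IsOpen (ψ '' (IsTri.Ins f g h ∪ tri f g h))ᶜ :=
    (hcl.image hψ.continuous).isClosed.isOpen_compl
  have o2 : IsOpen (ψ '' IsTri.Ins f g h) := hψ.isOpenMap _ T.Ins_open
  have hpt : p ∉ tri f g h := fun h => hd hp ⟨p, h, rfl⟩
  have := hS.subset_right_of_subset_union o1 o2 ?_ ?_ ⟨ψ p, hp, p, ⟨hpt, hw⟩, rfl⟩
  · obtain ⟨p', h', rfl⟩ := this hz
    exact ⟨p', rfl, h'.1, h'.2⟩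
  · rw [disjoint_left]
    rintro x hx ⟨y, hy, rfl⟩
    exact hx ⟨y, Or.inl hy, rfl⟩
  · intro x hx
    by_cases hh : x ∈ ψ '' (IsTri.Ins f g h ∪ tri f g h)
    · obtain ⟨y, hy | hy, rfl⟩ := hh
      · exact Or.inr ⟨y, hy, rfl⟩
      · exact absurd ⟨y, hy, rfl⟩ (hd hx)
    · exact Or.inl hh

lemma compOut [CompactSpace X] (hψ : IsOpenEmbedding ψ) (hr : range ψ = {q}ᶜ)
    (T : IsTri f g h) {p : ℂ} (hp : p ∉ tri f g h) (hw : wt f g h p = 0) :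
    q ∈ connectedComponentIn (ψ '' tri f g h)ᶜ (ψ p) := by
  set U := connectedComponentIn (tri f g h)ᶜ p with hU
  have hub := T.unbdd_of_wt hp hw
  have hqr : ∀ z, ψ z ≠ q := fun z hz => by
    have : ψ z ∈ ({q} : Set X)ᶜ := by rw [← hr]; exact mem_range_self z
    exact this hz
  have hqc : q ∈ closure (ψ '' U) := by
    rw [mem_closure_iff]
    intro O hO hq
    by_contra hne
    rw [not_nonempty_iff_eq_empty] at hne
    have hk : IsCompact (ψ ⁻¹' Oᶜ) := by
      refine (hψ.isInducing.isCompact_preimage_iff ?_).2 hO.isClosed_compl.isCompact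
      rw [hr]
      intro x hx hxq
      rw [mem_singleton_iff] at hxq
      subst hxq
      exact hx hq
    refine hub (hk.isBounded.subset ?_)
    intro z hz hzO
    have : ψ z ∈ O ∩ ψ '' U := ⟨hzO, z, hz, rfl⟩
    rw [hne] at this
    exact this
  have hpc : IsPreconnected (insert q (ψ '' U)) := by
    refine IsPreconnected.subset_closure
      (isPreconnected_connectedComponentIn.image ψ hψ.continuous.continuousOn)
      (subset_insert _ _) ?_
    rintro x (rfl | hx)
    · exact hqc
    · exact subset_closure hx
  refine hpc.subset_connectedComponentIn (Or.inr ⟨p, mem_connectedComponentIn hp, rfl⟩) ?_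
    (Or.inl rfl)
  rintro x (rfl | ⟨z, hz, rfl⟩)
  · rintro ⟨z, -, hz⟩
    exact hqr z hz
  · rintro ⟨w, hw, hwz⟩
    rw [hψ.injective hwz] at hw
    exact connectedComponentIn_subset _ _ hz hw

end chart

lemma im_rev (f : ℝ → ℂ) : im (fun t => f (1 - t)) = im f := by
  ext z
  constructor
  · rintro ⟨t, ht, rfl⟩
    exact ⟨1 - t, ⟨by linarith [ht.2], by linarith [ht.1]⟩, rfl⟩
  · rintro ⟨t, ht, rfl⟩
    exact ⟨1 - t, ⟨by linarith [ht.2], by linarith [ht.1]⟩, by simp⟩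

lemma cont_rev {f : ℝ → ℂ} (hf : ContinuousOn f (Icc 0 1)) :
    ContinuousOn (fun t => f (1 - t)) (Icc 0 1) := by
  refine hf.comp (by fun_prop) ?_
  intro t ht
  exact ⟨by linarith [ht.2], by linarith [ht.1]⟩

lemma inj_rev {f : ℝ → ℂ} (hf : InjOn f (Icc 0 1)) : InjOn (fun t => f (1 - t)) (Icc 0 1) := by
  intro s hs t ht h
  have := hf (x₁ := 1 - s) (x₂ := 1 - t) ⟨by linarith [hs.2], by linarith [hs.1]⟩
    ⟨by linarith [ht.2], by linarith [ht.1]⟩ h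
  linarith

/-- the conditions on a plane parametrisation of an edge -/
structure Par {n : ℕ} {X : Type*} [TopologicalSpace X] (D : GoodDrawing n X) (ψ : ℂ → X)
    (u v : Fin n) (f : ℝ → ℂ) : Prop where
  c : ContinuousOn f (Icc 0 1)
  j : InjOn f (Icc 0 1)
  e0 : ψ (f 0) = D.vtx u
  e1 : ψ (f 1) = D.vtx v
  e : D.arc u v = ψ '' im f

lemma Par.rev {n : ℕ} {X : Type*} [TopologicalSpace X] {D : GoodDrawing n X} {ψ : ℂ → X}
    {u v : Fin n} {f : ℝ → ℂ} (h : Par D ψ u v f) : Par D ψ v u (fun t => f (1 - t)) where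
  c := cont_rev h.c
  j := inj_rev h.j
  e0 := by simpa using h.e1
  e1 := by simpa using h.e0
  e := by rw [im_rev, ← h.e, D.arc_symm]

lemma exists_par {n : ℕ} {X : Type*} [TopologicalSpace X] (D : GoodDrawing n X) {ψ : ℂ → X} {q : X}
    (hψ : IsOpenEmbedding ψ) (hr : range ψ = {q}ᶜ) (hq : q ∉ D.image univ) {u v : Fin n}
    (huv : u ≠ v) : ∃ f, Par D ψ u v f := by
  obtain ⟨g, gc, gj, g0, g1, ge⟩ := D.isArc u v huv
  have hg : ∀ t ∈ Icc (0 : ℝ) 1, g t ∈ range ψ := by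
    intro t ht
    rw [hr]
    intro h
    apply hq
    rw [mem_singleton_iff] at h
    rw [← h]
    refine Or.inr ?_
    simp only [mem_iUnion]
    exact ⟨u, mem_univ _, v, mem_univ _, huv, by rw [ge]; exact ⟨t, ht, rfl⟩⟩
  have hf : ∀ t ∈ Icc (0 : ℝ) 1, ψ (Function.invFun ψ (g t)) = g t := fun t ht =>
    Function.invFun_eq (hg t ht)
  refine ⟨fun t => Function.invFun ψ (g t), ?_, ?_, ?_, ?_, ?_⟩
  · rw [hψ.isInducing.continuousOn_iff]
    exact gc.congr hf
  · intro s hs t ht h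
    apply gj hs ht
    rw [← hf s hs, ← hf t ht]
    exact congrArg ψ h
  · rw [hf 0 z01, g0]
  · rw [hf 1 o01, g1]
  · rw [ge]
    ext z
    constructor
    · rintro ⟨t, ht, rfl⟩
      exact ⟨_, mem_im ht, hf t ht⟩
    · rintro ⟨_, ⟨t, ht, rfl⟩, rfl⟩
      exact ⟨t, ht, (hf t ht).symm⟩

lemma exists_pars {n : ℕ} {X : Type*} [TopologicalSpace X] (D : GoodDrawing n X) {ψ : ℂ → X} {q : X}
    (hψ : IsOpenEmbedding ψ) (hr : range ψ = {q}ᶜ) (hq : q ∉ D.image univ) :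
    ∃ f : Fin n → Fin n → ℝ → ℂ, (∀ u v, u ≠ v → Par D ψ u v (f u v)) ∧
      ∀ u v, u ≠ v → f v u = fun t => f u v (1 - t) := by
  classical
  have H : ∀ u v : Fin n, ∃ f : ℝ → ℂ, u ≠ v → Par D ψ u v f := by
    intro u v
    by_cases h : u = v
    · exact ⟨fun _ => 0, fun h' => absurd h h'⟩
    · obtain ⟨f, hf⟩ := exists_par D hψ hr hq h
      exact ⟨f, fun _ => hf⟩
  choose g hg using H
  refine ⟨fun u v => if u < v then g u v else fun t => g v u (1 - t), ?_, ?_⟩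
  · intro u v huv
    by_cases h : u < v
    · simp only [h, if_true]; exact hg u v huv
    · simp only [h, if_false]; exact (hg v u huv.symm).rev
  · intro u v huv
    rcases lt_or_gt_of_ne huv with h | h
    · simp only [h, not_lt.2 h.le, if_true, if_false]
    · simp only [h, not_lt.2 h.le, if_true, if_false, sub_sub_cancel]

lemma tri_eq {n : ℕ} {X : Type*} [TopologicalSpace X] {D : GoodDrawing n X} {ψ : ℂ → X}
    {f : Fin n → Fin n → ℝ → ℂ} (hf : ∀ u v, u ≠ v → Par D ψ u v (f u v)) {a b c : Fin n}
    (hab : a ≠ b) (hbc : b ≠ c) (hca : c ≠ a) :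
    D.tri a b c = ψ '' tri (f a b) (f b c) (f c a) := by
  unfold GoodDrawing.tri tri
  rw [image_union, image_union, ← (hf a b hab).e, ← (hf b c hbc).e, ← (hf c a hca).e,
    D.arc_symm c a]

lemma arc_image {n : ℕ} {X : Type*} [TopologicalSpace X] (D : GoodDrawing n X) {u v : Fin n}
    (huv : u ≠ v) : D.arc u v ⊆ D.image univ := by
  intro z hz
  refine Or.inr ?_
  simp only [mem_iUnion]
  exact ⟨u, mem_univ _, v, mem_univ _, huv, hz⟩

lemma tri_image {n : ℕ} {X : Type*} [TopologicalSpace X] (D : GoodDrawing n X) {a b c : Fin n}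
    (hab : a ≠ b) (hbc : b ≠ c) (hca : c ≠ a) : D.tri a b c ⊆ D.image univ :=
  union_subset (union_subset (arc_image D hab) (arc_image D hbc)) (arc_image D hca.symm)

theorem transfer {n : ℕ} (hn : 3 ≤ n) (D : GoodDrawing n SpherePt)
    (F : Set SpherePt) (hFC : D.FaceConvex F) :
    ∃ π : Equiv.Perm (Fin n), ∀ a b c : Fin n, a ≠ b → a ≠ c → b ≠ c →
      ∀ Δ : Set SpherePt, IsClosedSide (D.tri a b c) Δ → ¬F ⊆ Δ →
        ∀ x : Fin n, D.vtx x ∈ interior Δ →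
          (∃ y ∈ ({a, b, c} : Set (Fin n)), π y < π x) ∧
          (∃ y ∈ ({a, b, c} : Set (Fin n)), π x < π y) := by
  obtain ⟨⟨q, hq, hF⟩, hconv⟩ := hFC
  obtain ⟨ψ, hψ, hr⟩ := exists_chart q
  obtain ⟨f, hf, hrev⟩ := exists_pars D hψ hr hq
  have hqF : q ∈ F := by rw [hF]; exact mem_connectedComponentIn hq
  have hqr : ∀ z, ψ z ≠ q := fun z hz => by
    have : ψ z ∈ ({q} : Set SpherePt)ᶜ := by rw [← hr]; exact mem_range_self z
    exact this hz
  have hv : ∀ u, ∃ z, ψ z = D.vtx u := by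
    intro u
    change D.vtx u ∈ range ψ
    rw [hr]
    intro h
    rw [mem_singleton_iff] at h
    exact hq (h ▸ Or.inl ⟨u, mem_univ _, rfl⟩)
  choose vt hvt using hv
  have f0 : ∀ u v, u ≠ v → f u v 0 = vt u := fun u v h =>
    hψ.injective (by rw [(hf u v h).e0, hvt])
  have f1 : ∀ u v, u ≠ v → f u v 1 = vt v := fun u v h =>
    hψ.injective (by rw [(hf u v h).e1, hvt])
  have mi : ∀ u v, u ≠ v → ∀ z, z ∈ im (f u v) ↔ ψ z ∈ D.arc u v := by
    intro u v h z
    rw [(hf u v h).e, hψ.injective.mem_set_image]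
  have vnot : ∀ u v w, u ≠ v → w ≠ u → w ≠ v → vt w ∉ im (f u v) := by
    intro u v w h1 h2 h3 h
    rw [mi u v h1, hvt] at h
    exact D.vtx_not_mem u v w h1 h2 h3 h
  have adj : ∀ u v w, u ≠ v → u ≠ w → v ≠ w → im (f u v) ∩ im (f u w) ⊆ {vt u} := by
    rintro u v w h1 h2 h3 z ⟨hz1, hz2⟩
    rw [mi u v h1] at hz1
    rw [mi u w h2] at hz2
    have : ψ z ∈ D.arc u v ∩ D.arc u w := ⟨hz1, hz2⟩
    rw [D.adj_arcs u v w h1 h2 h3, mem_singleton_iff, ← hvt] at this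
    exact hψ.injective this
  have TT : ∀ {a b c : Fin n}, a ≠ b → b ≠ c → c ≠ a → IsTri (f a b) (f b c) (f c a) := by
    intro a b c hab hbc hca
    have aux : ∀ {a b c : Fin n}, a ≠ b → b ≠ c → c ≠ a →
        im (f a b) ∩ im (f b c) ⊆ {f a b 1} := by
      rintro a b c hab hbc hca z ⟨h1, h2⟩
      rw [f1 a b hab]
      rw [mi a b hab, D.arc_symm, ← mi b a hab.symm] at h1
      exact adj b a c hab.symm hbc hca.symm ⟨h1, h2⟩
    exact ⟨(hf a b hab).c, (hf b c hbc).c, (hf c a hca).c, (hf a b hab).j, (hf b c hbc).j,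
      (hf c a hca).j, by rw [f1 a b hab, f0 b c hbc], by rw [f1 b c hbc, f0 c a hca],
      by rw [f1 c a hca, f0 a b hab], aux hab hbc hca, aux hbc hca hab, aux hca hab hbc⟩
  have hqtri : ∀ (S : Set ℂ), q ∉ ψ '' S := by
    rintro S ⟨z, -, hz⟩
    exact hqr z hz
  let P : PD n :=
    { vtx := vt
      f := f
      cont := fun u v h => (hf u v h).c
      inj := fun u v h => (hf u v h).j
      f0 := f0
      f1 := f1
      rev := hrev
      vinj := fun u v h => D.vtx_inj (by rw [← hvt, ← hvt, h])
      vnot := vnot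
      adj := adj
      cr := by
        rintro u v x y huv hxy ux uy vx vy r ⟨h1, h2⟩
        obtain ⟨hs, hc⟩ := D.indep_arcs u v x y huv hxy ux uy vx vy
        rw [mi u v huv] at h1
        rw [mi x y hxy] at h2
        constructor
        · rintro z ⟨z1, z2⟩
          rw [mi u v huv] at z1
          rw [mi x y hxy] at z2
          exact hψ.injective (hs ⟨z1, z2⟩ ⟨h1, h2⟩)
        · have := (hc _ ⟨h1, h2⟩).1
          rw [(hf u v huv).e, (hf x y hxy).e] at this
          exact crosses_pull hψ this
      conv := by
        intro a b c x hab hbc hca xa xb xc hw p hp hpt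
        have hxt : vt x ∉ tri (f a b) (f b c) (f c a) := by
          rintro ((h | h) | h)
          · exact vnot a b x hab xa xb h
          · exact vnot b c x hbc xb xc h
          · exact vnot c a x hca xc xa h
        have ht := tri_eq hf hab hbc hca
        have hxt' : D.vtx x ∉ D.tri a b c := by
          rw [ht, ← hvt, hψ.injective.mem_set_image]; exact hxt
        have key : ∀ z ∈ connectedComponentIn (D.tri a b c)ᶜ (D.vtx x),
            ∃ p', z = ψ p' ∧ p' ∉ tri (f a b) (f b c) (f c a) ∧
              wt (f a b) (f b c) (f c a) p' ≠ 0 := by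
          intro z hz
          refine sepA hψ (TT hab hbc hca) isPreconnected_connectedComponentIn ?_ ?_ hw hz
          · rw [← ht]; exact connectedComponentIn_subset _ _
          · rw [hvt]; exact mem_connectedComponentIn hxt'
        have hD := hconv a b c hab hca.symm hbc _ ⟨D.vtx x, hxt', rfl⟩ (by
          intro hsub
          rcases hsub hqF with h | h
          · obtain ⟨p', h, -⟩ := key q h
            exact hqr p' h.symm
          · rw [ht] at h
            exact hqtri _ h)
        have harc := hD x a xa (Or.inl (mem_connectedComponentIn hxt')) (by
          refine Or.inr (Or.inl (Or.inl ?_))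
          rw [← hvt, ← mi a b hab, ← f0 a b hab]
          exact mem_im z01)
        rw [mi x a xa] at hp
        rcases harc hp with h | h
        · obtain ⟨p', e, -, h'⟩ := key _ h
          rwa [hψ.injective e]
        · rw [ht, hψ.injective.mem_set_image] at h
          exact absurd h hpt }
  obtain ⟨π, hπ⟩ := PD.main hn P
  refine ⟨π, ?_⟩
  rintro a b c hab hac hbc Δ ⟨q', hq', rfl⟩ hFΔ x hx
  have hca := hac.symm
  have ht := tri_eq hf hab hbc hca
  have TA := TT hab hbc hca
  have hqn : q ∉ connectedComponentIn (D.tri a b c)ᶜ q' := by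
    intro h
    apply hFΔ
    intro z hz
    left
    rw [connectedComponentIn_eq h]
    rw [hF] at hz
    exact connectedComponentIn_mono _ (compl_subset_compl.2 (tri_image D hab hbc hca)) hz
  have hne : ∀ p, p ∉ tri (f a b) (f b c) (f c a) →
      ψ p ∈ connectedComponentIn (D.tri a b c)ᶜ q' → wt (f a b) (f b c) (f c a) p ≠ 0 := by
    intro p hp hpc hw
    apply hqn
    rw [connectedComponentIn_eq hpc, ht]
    exact compOut hψ hr TA hp hw
  rw [← hvt] at hx
  have hxt : vt x ∉ tri (f a b) (f b c) (f c a) := by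
    intro h
    obtain ⟨p, hp1, hp2⟩ := mem_closure_iff.1 (TA.tri_Out h) _
      (isOpen_interior.preimage hψ.continuous) hx
    rcases interior_subset hp1 with h | h
    · exact hne p hp2.1 h hp2.2
    · rw [ht, hψ.injective.mem_set_image] at h
      exact hp2.1 h
  have hxw : wt (f a b) (f b c) (f c a) (vt x) ≠ 0 := by
    refine hne _ hxt ?_
    rcases interior_subset hx with h | h
    · exact h
    · rw [ht, hψ.injective.mem_set_image] at h
      exact absurd h hxt
  have va : vt a ∈ im (f a b) := by rw [← f0 a b hab]; exact mem_im z01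
  have vb : vt b ∈ im (f a b) := by rw [← f1 a b hab]; exact mem_im o01
  have vc : vt c ∈ im (f b c) := by rw [← f1 b c hbc]; exact mem_im o01
  obtain ⟨⟨y, hy, hy'⟩, ⟨z, hz, hz'⟩⟩ := hπ a b c x hab hbc hca
    (by rintro rfl; exact hxt (Or.inl (Or.inl va)))
    (by rintro rfl; exact hxt (Or.inl (Or.inl vb)))
    (by rintro rfl; exact hxt (Or.inl (Or.inr vc))) hxw
  exact ⟨⟨y, by simpa using hy, hy'⟩, ⟨z, by simpa using hz, hz'⟩⟩

end IVO

/-- Every face-convex drawing of `K_n` admits a linear ordering of the vertices with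
the intermediate value property. -/
theorem faceConvex_has_IV_ordering (n : ℕ) (D : GoodDrawing n SpherePt)
    (F : Set SpherePt) (hFC : D.FaceConvex F) :
    ∃ π : Equiv.Perm (Fin n), ∀ a b c : Fin n, a ≠ b → a ≠ c → b ≠ c →
      ∀ Δ : Set SpherePt, IsClosedSide (D.tri a b c) Δ → ¬F ⊆ Δ →
        ∀ x : Fin n, D.vtx x ∈ interior Δ →
          (∃ y ∈ ({a, b, c} : Set (Fin n)), π y < π x) ∧
          (∃ y ∈ ({a, b, c} : Set (Fin n)), π x < π y) := by
  by_cases hn : 3 ≤ n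
  · exact IVO.transfer hn D F hFC
  · refine ⟨1, fun a b c h1 h2 h3 => ?_⟩
    have := a.2
    have := b.2
    have := c.2
    have := Fin.val_ne_of_ne h1
    have := Fin.val_ne_of_ne h2
    have := Fin.val_ne_of_ne h3
    omega

end
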